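/- arXiv:2508.12717 — 3 statements merged into one kernel-verified Lean document; each statement's English description precedes it below -/
import Mathlib

section
/- Let g ≥ 1 and let n, h be integers with 1 ≤ h ≤ n. There exists a bijection φ from S_{n−1} × {0, 1, …, n−1} onto S_n such that for every σ ∈ S_{n−1} and every integer c with 0 ≤ c ≤ n−1: g den_h(φ(σ,c)) = g den_h(σ) + c, and for every integer ℓ ≥ 1 with g + ℓ ≥ h, g exc_ℓ(φ(σ,c)) = g exc_ℓ(σ) if 0 ≤ c ≤ g exc_ℓ(σ) + g + ℓ − 2, and g exc_ℓ(φ(σ,c)) = g exc_ℓ(σ) + 1 otherwise. -/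
open Finset

namespace PaperStmt

/-- 1-based position of `i : Fin n` (so positions run through `1,…,n`). -/
def pos1 {n : ℕ} (i : Fin n) : ℕ := (i : ℕ) + 1

/-- 1-based value `σ_i` of the permutation `σ` at position `i`. -/
def val1 {n : ℕ} (σ : Equiv.Perm (Fin n)) (i : Fin n) : ℕ := (σ i : ℕ) + 1

/-- The number of inversions of the subsequence of `σ` consisting of the letters at the
positions satisfying `P`: pairs of positions `i < j`, both satisfying `P`,
with `σ_i > σ_j`. -/
def invOn {n : ℕ} (σ : Equiv.Perm (Fin n)) (P : Fin n → Prop) [DecidablePred P] : ℕ :=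
  (univ.filter fun p : Fin n × Fin n =>
    p.1 < p.2 ∧ P p.1 ∧ P p.2 ∧ val1 σ p.2 < val1 σ p.1).card

/-- `inv σ`: the number of inversions of `σ`. -/
def inv {n : ℕ} (σ : Equiv.Perm (Fin n)) : ℕ := invOn σ (fun _ => True)

/-- `Exc(σ)`: the set of excedances, i.e. positions `i` with `σ_i > i`. -/
def excSet {n : ℕ} (σ : Equiv.Perm (Fin n)) : Finset (Fin n) :=
  univ.filter fun i => pos1 i < val1 σ i

/-- `exc σ`: the number of excedances. -/
def exc {n : ℕ} (σ : Equiv.Perm (Fin n)) : ℕ := (excSet σ).card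

/-- `exc_r(σ)`: the number of `r`-level excedances, i.e. positions `i ≥ r` with `σ_i > i`. -/
def excLvl {n : ℕ} (r : ℕ) (σ : Equiv.Perm (Fin n)) : ℕ :=
  (univ.filter fun i => pos1 i < val1 σ i ∧ r ≤ pos1 i).card

/-- Denert's statistic `den σ`. -/
def den {n : ℕ} (σ : Equiv.Perm (Fin n)) : ℕ :=
  ((univ.filter fun i => pos1 i < val1 σ i).sum pos1)
  + invOn σ (fun i => pos1 i < val1 σ i)
  + invOn σ (fun i => ¬ pos1 i < val1 σ i)

/-- The `h`-level Denert statistic `den_h(σ)`. -/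
def denLvl {n : ℕ} (h : ℕ) (σ : Equiv.Perm (Fin n)) : ℕ :=
  ((univ.filter fun i => pos1 i < val1 σ i ∧ h ≤ val1 σ i).sum pos1)
  + invOn σ (fun i => pos1 i < val1 σ i ∧ h ≤ val1 σ i)
  + invOn σ (fun i => ¬ (pos1 i < val1 σ i ∧ h ≤ val1 σ i))

/-- `g exc_ℓ(σ)`: the number of `g`-gap `ℓ`-level excedances,
i.e. positions `i ≥ ℓ` with `σ_i ≥ i + g`. -/
def gexc {n : ℕ} (g l : ℕ) (σ : Equiv.Perm (Fin n)) : ℕ :=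
  (univ.filter fun i => pos1 i + g ≤ val1 σ i ∧ l ≤ pos1 i).card

/-- `gExclp_h(σ)`: the set of `g`-gap `h`-level excedance-letter positions,
i.e. positions `i` with `σ_i ≥ i + g` and `σ_i ≥ h`. -/
def gExclpSet {n : ℕ} (g h : ℕ) (σ : Equiv.Perm (Fin n)) : Finset (Fin n) :=
  univ.filter fun i => pos1 i + g ≤ val1 σ i ∧ h ≤ val1 σ i

/-- The `g`-gap `h`-level Denert statistic `g den_h(σ)`. -/
def gden {n : ℕ} (g h : ℕ) (σ : Equiv.Perm (Fin n)) : ℕ :=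
  ((univ.filter fun i => pos1 i + g ≤ val1 σ i ∧ h ≤ val1 σ i).sum fun i => pos1 i + g - 1)
  + invOn σ (fun i => pos1 i + g ≤ val1 σ i ∧ h ≤ val1 σ i)
  + invOn σ (fun i => ¬ (pos1 i + g ≤ val1 σ i ∧ h ≤ val1 σ i))

/-- `rexc σ`: the number of `r`-excedances, i.e. positions `i` with `σ_i ≥ i + r`. -/
def rexc {n : ℕ} (r : ℕ) (σ : Equiv.Perm (Fin n)) : ℕ :=
  (univ.filter fun i => pos1 i + r ≤ val1 σ i).card

/-- The `r`-Denert statistic `rden σ`. -/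
def rden {n : ℕ} (r : ℕ) (σ : Equiv.Perm (Fin n)) : ℕ :=
  ((univ.filter fun i => pos1 i + r ≤ val1 σ i).sum fun i => pos1 i + r - 1)
  + invOn σ (fun i => pos1 i + r ≤ val1 σ i)
  + invOn σ (fun i => ¬ pos1 i + r ≤ val1 σ i)

/-- Pairs `(i, i+1)` of adjacent positions forming an `r`-descent: `σ_i ≥ σ_{i+1} + r`. -/
def rdesPairs {n : ℕ} (r : ℕ) (σ : Equiv.Perm (Fin n)) : Finset (Fin n × Fin n) :=
  univ.filter fun p => pos1 p.2 = pos1 p.1 + 1 ∧ val1 σ p.2 + r ≤ val1 σ p.1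

/-- `rdes σ`: the number of `r`-descents. -/
def rdes {n : ℕ} (r : ℕ) (σ : Equiv.Perm (Fin n)) : ℕ := (rdesPairs r σ).card

/-- `rmaj σ`: the sum of the `r`-descents plus the number of pairs `i < j`
with `σ_j < σ_i < σ_j + r`. -/
def rmaj {n : ℕ} (r : ℕ) (σ : Equiv.Perm (Fin n)) : ℕ :=
  ((rdesPairs r σ).sum fun p => pos1 p.1)
  + (univ.filter fun p : Fin n × Fin n =>
      p.1 < p.2 ∧ val1 σ p.2 < val1 σ p.1 ∧ val1 σ p.1 < val1 σ p.2 + r).card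

/-- `des σ`: the number of descents, i.e. positions `i ∈ [n-1]` with `σ_i > σ_{i+1}`. -/
def des {n : ℕ} (σ : Equiv.Perm (Fin n)) : ℕ :=
  (univ.filter fun p : Fin n × Fin n =>
    pos1 p.2 = pos1 p.1 + 1 ∧ val1 σ p.2 < val1 σ p.1).card

/-- `maj σ`: the major index, i.e. the sum of the descents of `σ`. -/
def maj {n : ℕ} (σ : Equiv.Perm (Fin n)) : ℕ :=
  ((univ.filter fun p : Fin n × Fin n =>
    pos1 p.2 = pos1 p.1 + 1 ∧ val1 σ p.2 < val1 σ p.1).sum fun p => pos1 p.1)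

section Transfer

variable {R : Type*} [CommRing R]

/-- The `q`-integer `1 + q + ⋯ + q ^ (k - 1)`. -/
def qInt (q : R) (k : ℕ) : R := ∑ j ∈ range k, q ^ j

lemma qInt_zero (q : R) : qInt q 0 = 0 := by simp [qInt]

lemma qInt_succ (q : R) (k : ℕ) : qInt q (k + 1) = 1 + q * qInt q k := by
  rw [qInt, sum_range_succ', qInt, mul_sum, add_comm]
  simp [pow_succ']

lemma qInt_succ' (q : R) (k : ℕ) : qInt q (k + 1) = qInt q k + q ^ k := by
  rw [qInt, sum_range_succ, qInt]

lemma qInt_add (q : R) (a b : ℕ) : qInt q (a + b) = qInt q a + q ^ a * qInt q b := by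
  induction b with
  | zero => simp [qInt_zero]
  | succ b ih => rw [← add_assoc, qInt_succ', ih, qInt_succ', pow_add]; ring

/-- Transfer operator of an excedance position, acting on weights indexed by the number of
excedance positions still waiting for a letter. -/
def stepExc (q : R) (v : ℕ → R) (H : ℕ) : R :=
  qInt q H * v (H - 1) + qInt q (H + 1) * v H

/-- Transfer operator of a non-excedance position. -/
def stepNexc (q : R) (g : ℕ) (v : ℕ → R) (H : ℕ) : R :=
  qInt q (H + g) * v H + qInt q (H + 1 + g) * v (H + 1)

/-- The weights after `r` steps, with excedances exactly at the steps in `P`. -/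
def evolve (q : R) (g : ℕ) (P : Finset ℕ) (v : ℕ → R) : ℕ → ℕ → R
  | 0 => v
  | r + 1 => if r ∈ P then stepExc q (evolve q g P v r) else stepNexc q g (evolve q g P v r)

lemma evolve_congr (q : R) (g : ℕ) {P P' : Finset ℕ} (v : ℕ → R) (r : ℕ)
    (h : ∀ i < r, i ∈ P ↔ i ∈ P') : evolve q g P v r = evolve q g P' v r := by
  induction r with
  | zero => rfl
  | succ r ih =>
    rw [evolve, evolve, ih fun i hi => h i (by lia)]
    simp only [h r (by lia)]

lemma stepNexc_stepExc (q : R) (g : ℕ) (v : ℕ → R) (H : ℕ) :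
    stepNexc q g (stepExc q v) H =
      q * stepExc q (stepNexc q g v) H + stepNexc q g v H + stepExc q v H := by
  rcases H with _ | H
  · simp only [stepNexc, stepExc, Nat.zero_sub, Nat.add_sub_cancel, qInt_zero,
      show 0 + 1 + g = (0 + g) + 1 by ring, qInt_succ]
    ring
  · simp only [stepNexc, stepExc, Nat.add_sub_cancel,
      show H + 1 + 1 + g = H + g + 1 + 1 by ring, show H + 1 + g = H + g + 1 by ring, qInt_succ]
    ring

lemma stepExc_add_sum (q : R) (a : R) (v : ℕ → R) (P : Finset ℕ) (c : ℕ → R) (w : ℕ → ℕ → R)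
    (H : ℕ) : stepExc q (fun H => a * v H + ∑ p ∈ P, c p * w p H) H =
      a * stepExc q v H + ∑ p ∈ P, c p * stepExc q (w p) H := by
  simp only [stepExc, mul_add, mul_sum, sum_add_distrib, mul_left_comm (c _)]
  ring

lemma stepNexc_add_sum (q : R) (g : ℕ) (a : R) (v : ℕ → R) (P : Finset ℕ) (c : ℕ → R)
    (w : ℕ → ℕ → R) (H : ℕ) : stepNexc q g (fun H => a * v H + ∑ p ∈ P, c p * w p H) H =
      a * stepNexc q g v H + ∑ p ∈ P, c p * stepNexc q g (w p) H := by
  simp only [stepNexc, mul_add, mul_sum, sum_add_distrib, mul_left_comm (c _)]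
  ring

lemma stepNexc_evolve (q : R) (g K : ℕ) (v : ℕ → R)
    (hv : ∀ H, stepNexc q g v H = qInt q K * v H) (r : ℕ) :
    ∀ P ⊆ range r, ∀ H, stepNexc q g (evolve q g P v r) H =
      qInt q (#P + K) * evolve q g P v r H
        + ∑ p ∈ P, q ^ #{x ∈ P | p < x} * evolve q g (P.erase p) v r H := by
  induction r with
  | zero =>
    intro P hP H
    obtain rfl : P = ∅ := by simpa using hP
    simp [evolve, hv]
  | succ r ih =>
    intro P hP H
    by_cases hr : r ∈ P
    · obtain ⟨S, hrS, rfl⟩ : ∃ S, r ∉ S ∧ P = insert r S :=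
        ⟨P.erase r, notMem_erase _ _, (insert_erase hr).symm⟩
      have hS : S ⊆ range r := by
        intro x hx
        have := hP (mem_insert_of_mem hx)
        simp only [mem_range] at this ⊢
        have : x ≠ r := fun h => hrS (h ▸ hx)
        lia
      have hev : evolve q g (insert r S) v r = evolve q g S v r :=
        evolve_congr q g v r fun i hi => by simp [hi.ne]
      have hIH : stepNexc q g (evolve q g S v r) = fun H => qInt q (#S + K) * evolve q g S v r H
          + ∑ p ∈ S, q ^ #{x ∈ S | p < x} * evolve q g (S.erase p) v r H :=
        funext (ih S hS)
      have hsum : ∀ p ∈ S, q ^ #{x ∈ insert r S | p < x} *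
          evolve q g ((insert r S).erase p) v (r + 1) H =
          q * (q ^ #{x ∈ S | p < x} * stepExc q (evolve q g (S.erase p) v r) H) := by
        intro p hp
        have hpr : p < r := mem_range.1 (hS hp)
        rw [evolve, if_pos (by simp [hpr.ne']),
          evolve_congr q g (P' := S.erase p) v r fun i hi => by simp [hi.ne],
          filter_insert, if_pos hpr, card_insert_of_notMem (by simp [hrS]), pow_succ]
        ring
      have hlast : #{x ∈ insert r S | r < x} = 0 := by
        rw [card_eq_zero, filter_eq_empty_iff]
        intro x hx
        have := mem_range.1 (hP hx)
        lia
      rw [sum_insert hrS, sum_congr rfl hsum, erase_insert hrS, hlast, evolve, evolve,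
        if_pos (mem_insert_self _ _), if_neg hrS, hev, stepNexc_stepExc, hIH, stepExc_add_sum,
        card_insert_of_notMem hrS, show #S + 1 + K = #S + K + 1 by ring, qInt_succ, ← mul_sum]
      ring
    · have hS : P ⊆ range r := by
        intro x hx
        have := hP hx
        simp only [mem_range] at this ⊢
        have : x ≠ r := fun h => hr (h ▸ hx)
        lia
      have hIH : stepNexc q g (evolve q g P v r) = fun H => qInt q (#P + K) * evolve q g P v r H
          + ∑ p ∈ P, q ^ #{x ∈ P | p < x} * evolve q g (P.erase p) v r H :=
        funext (ih P hS)
      have hsum : ∀ p ∈ P, q ^ #{x ∈ P | p < x} * evolve q g (P.erase p) v (r + 1) H =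
          q ^ #{x ∈ P | p < x} * stepNexc q g (evolve q g (P.erase p) v r) H := by
        intro p hp
        rw [evolve, if_neg (by simp [hr])]
      rw [sum_congr rfl hsum, evolve, if_neg hr, ← stepNexc_add_sum, ← hIH]

/-- The elementary symmetric polynomials of `q ^ g, …, q ^ (g + m - 1)`. -/
def qElem (q : R) (g m H : ℕ) : R :=
  ∑ S ∈ powersetCard H (range m), q ^ ∑ i ∈ S, (i + g)

lemma qElem_zero_right (q : R) (g m : ℕ) : qElem q g m 0 = 1 := by simp [qElem]

lemma qElem_zero_left (q : R) (g H : ℕ) : qElem q g 0 (H + 1) = 0 := by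
  rw [qElem, powersetCard_eq_empty.2 (by simp), sum_empty]

lemma qElem_succ (q : R) (g m H : ℕ) :
    qElem q g (m + 1) (H + 1) = qElem q g m (H + 1) + q ^ (g + m) * qElem q g m H := by
  rw [qElem, range_add_one, powersetCard_succ_insert (by simp), sum_union, sum_image]
  · congr 1
    rw [qElem, mul_sum]
    refine sum_congr rfl fun S hS => ?_
    have : m ∉ S := fun h => by simpa using (mem_powersetCard.1 hS).1 h
    rw [sum_insert this, pow_add, add_comm g m]
  · intro S hS S' hS' h
    have h1 : m ∉ S := fun h => by simpa using (mem_powersetCard.1 hS).1 h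
    have h2 : m ∉ S' := fun h => by simpa using (mem_powersetCard.1 hS').1 h
    rw [← erase_insert h1, ← erase_insert h2, h]
  · rw [disjoint_left]
    intro S hS hS'
    obtain ⟨S', -, rfl⟩ := mem_image.1 hS'
    simpa using (mem_powersetCard.1 hS).1 (mem_insert_self m S')

lemma qElem_eq_zero (q : R) (g : ℕ) {m H : ℕ} (h : m < H) : qElem q g m H = 0 := by
  rw [qElem, powersetCard_eq_empty.2 (by simpa using h), sum_empty]

lemma qElem_rec (q : R) (g m : ℕ) : ∀ H, 
    qElem q g m (H + 1) * qInt q (H + 1) = q ^ (g + H) * qInt q (m - H) * qElem q g m H := by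
  induction m with
  | zero => intro H; simp [qElem_zero_left, qInt_zero]
  | succ m ih =>
    intro H
    rcases lt_or_ge m H with hH | hH
    · rw [qElem_eq_zero q g (by lia), show m + 1 - H = 0 by lia, qInt_zero]; ring
    obtain ⟨d, rfl⟩ := Nat.exists_eq_add_of_le hH
    rw [qElem_succ, add_mul, ih H]
    rcases H with _ | H
    · simp only [qElem_zero_right, qInt_succ', qInt_zero, zero_add, Nat.sub_zero, add_zero]; ring
    · rw [qElem_succ]
      have h := ih H
      rw [show H + 1 + d - H = d + 1 by lia] at h
      rw [show H + 1 + d - (H + 1) = d by lia, show H + 1 + d + 1 - (H + 1) = d + 1 by lia,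
        qInt_succ q (H + 1)]
      rw [qInt_succ' q H, qInt_succ' q d] at h
      rw [qInt_succ' q H, qInt_succ' q d]
      linear_combination q * q ^ (g + (H + 1 + d)) * h

/-- The weights after the positions below the level. -/
def initWeight (q : R) (g m H : ℕ) : R :=
  qElem q g m H * ((∏ j ∈ range H, qInt q (j + 1)) * ∏ j ∈ range (m - H), qInt q (g + m - j))

lemma stepNexc_initWeight (q : R) (g m H : ℕ) :
    stepNexc q g (initWeight q g m) H = qInt q (g + m) * initWeight q g m H := by
  rcases lt_or_ge m H with hH | hH
  · simp [stepNexc, initWeight, qElem_eq_zero q g hH, qElem_eq_zero q g (Nat.lt_succ_of_lt hH)]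
  obtain ⟨d, rfl⟩ := Nat.exists_eq_add_of_le hH
  have h := qElem_rec q g (H + d) H
  have hK : qInt q (g + (H + d)) = qInt q (H + g) + q ^ (g + H) * qInt q d := by
    rw [← add_assoc, add_comm g H, qInt_add]
  rw [hK]
  simp only [stepNexc, initWeight, prod_range_succ _ H]
  rw [show H + d - H = d by lia] at *
  rcases d with _ | d
  · rw [qInt_zero] at h
    rw [qElem_eq_zero q g (show H + 0 < H + 1 by lia), qInt_zero]
    ring
  · rw [show H + (d + 1) - (H + 1) = d by lia, prod_range_succ _ d,
      show g + (H + (d + 1)) - d = H + 1 + g by lia]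
    linear_combination (qInt q (H + 1 + g) * (∏ j ∈ range H, qInt q (j + 1)) *
      ∏ j ∈ range d, qInt q (g + (H + (d + 1)) - j)) * h

end Transfer

section Threshold

/-- The increment of Denert's statistic caused by adding the excedance position `p` to `P`. -/
def threshold (K : ℕ) (P : Finset ℕ) (p : ℕ) : ℕ := K + p + #{x ∈ P | p < x}

/-- The set of excedance positions after an insertion with increment `c`. -/
def insertPos (K N : ℕ) (P : Finset ℕ) (c : ℕ) : Finset ℕ :=
  P ∪ {p ∈ range (N + 1) | p ∉ P ∧ threshold K P p = c}

lemma card_filter_le_le_add (P : Finset ℕ) {s p : ℕ} (hp : p ∉ P) :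
    #{x ∈ P | s ≤ x} ≤ #{x ∈ P | p < x} + (p - s) := by
  calc #{x ∈ P | s ≤ x} ≤ #({x ∈ P | p < x} ∪ Ico s p) := by
        refine card_le_card fun x hx => ?_
        have : x ≠ p := fun e => hp (e ▸ (mem_filter.1 hx).1)
        simp only [mem_filter, mem_union, mem_Ico] at hx ⊢
        grind
    _ ≤ _ := (card_union_le _ _).trans (by simp)

lemma threshold_lt (K : ℕ) (P : Finset ℕ) {p p' : ℕ} (hp' : p' ∉ P) (h : p < p') :
    threshold K P p < threshold K P p' := by
  have := card_filter_le_le_add P (s := p + 1) hp'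
  simp only [Nat.add_one_le_iff] at this
  simp only [threshold]
  lia

lemma threshold_injOn (K : ℕ) (P : Finset ℕ) {p p' : ℕ} (hp : p ∉ P) (hp' : p' ∉ P)
    (h : threshold K P p = threshold K P p') : p = p' := by
  rcases lt_trichotomy p p' with h' | h' | h'
  · exact absurd h (threshold_lt K P hp' h').ne
  · exact h'
  · exact absurd h (threshold_lt K P hp h').ne'

lemma image_threshold (K N : ℕ) {P : Finset ℕ} (hP : P ⊆ range N) :
    (range (N + 1) \ P).image (threshold K P) = Ico (#P + K) (K + N + 1) := by
  apply eq_of_subset_of_card_le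
  · intro c hc
    obtain ⟨p, hp, rfl⟩ := mem_image.1 hc
    rw [mem_sdiff, mem_range] at hp
    have h1 := card_filter_le_le_add P (s := 0) hp.2
    simp only [Nat.zero_le, filter_true, Nat.sub_zero] at h1
    have h2 : #{x ∈ P | p < x} ≤ #(Ioo p N) := by
      refine card_le_card fun x hx => ?_
      simp only [mem_filter, mem_Ioo] at hx ⊢
      exact ⟨hx.2, mem_range.1 (hP hx.1)⟩
    rw [Nat.card_Ioo] at h2
    rw [mem_Ico, threshold]
    lia
  · rw [card_image_of_injOn, Nat.card_Ico, card_sdiff_of_subset, card_range]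
    · lia
    · exact hP.trans (range_subset_range.2 (Nat.le_succ N))
    · intro p hp p' hp' h
      simp only [coe_sdiff, Set.mem_sdiff, mem_coe] at hp hp'
      exact threshold_injOn K P hp.2 hp'.2 h

lemma insertPos_of_lt (K N : ℕ) {P : Finset ℕ} (hP : P ⊆ range N) {c : ℕ} (hc : c < #P + K) :
    insertPos K N P c = P := by
  rw [insertPos, union_eq_left]
  intro p hp
  rw [mem_filter] at hp
  have := mem_image_of_mem (threshold K P) (mem_sdiff.2 ⟨hp.1, hp.2.1⟩)
  rw [image_threshold K N hP, mem_Ico, hp.2.2] at this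
  lia

lemma insertPos_threshold (K N : ℕ) {P : Finset ℕ} {p : ℕ} (hp : p ∉ P) (hpN : p < N + 1) :
    insertPos K N P (threshold K P p) = insert p P := by
  ext x
  simp only [insertPos, mem_union, mem_filter, mem_range, mem_insert]
  constructor
  · rintro (h | ⟨-, h, h'⟩)
    · exact .inr h
    · exact .inl (threshold_injOn K P h hp h')
  · rintro (rfl | h)
    · exact .inr ⟨hpN, hp, rfl⟩
    · exact .inl h

lemma card_insertPos (K N : ℕ) {P : Finset ℕ} (hP : P ⊆ range N) {c : ℕ} (hc : c < K + N + 1)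
    (s : ℕ) : #{x ∈ insertPos K N P c | s ≤ x} =
      if c < #{x ∈ P | s ≤ x} + K + s then #{x ∈ P | s ≤ x} else #{x ∈ P | s ≤ x} + 1 := by
  have hs : #P ≤ #{x ∈ P | s ≤ x} + s := by
    rw [← card_filter_add_card_filter_not (s := P) (s ≤ ·)]
    gcongr
    calc #{x ∈ P | ¬ s ≤ x} ≤ #(range s) := card_le_card fun x hx => by
          simp only [mem_filter, mem_range] at hx ⊢; lia
      _ = s := card_range s
  rcases lt_or_ge c (#P + K) with h | h
  · rw [insertPos_of_lt K N hP h, if_pos (by lia)]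
  · have hc' : c ∈ Ico (#P + K) (K + N + 1) := mem_Ico.2 ⟨h, hc⟩
    rw [← image_threshold K N hP] at hc'
    obtain ⟨p, hp, rfl⟩ := mem_image.1 hc'
    rw [mem_sdiff, mem_range] at hp
    rw [insertPos_threshold K N hp.2 hp.1, filter_insert]
    rcases lt_or_ge p s with hps | hps
    · rw [if_neg (by lia), if_pos]
      have : #{x ∈ P | p < x} ≤ #({x ∈ P | s ≤ x} ∪ Ioo p s) := card_le_card fun x hx => by
          simp only [mem_filter, mem_union, mem_Ioo] at hx ⊢
          grind
      have := this.trans (card_union_le _ _)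
      rw [Nat.card_Ioo] at this
      rw [threshold]
      lia
    · rw [if_pos hps, if_neg, card_insert_of_notMem (by simp [hp.2])]
      have := card_filter_le_le_add P (s := s) hp.2
      rw [threshold]
      lia

lemma sum_insertPos {R : Type*} [CommRing R] (q : R) (f : Finset ℕ → R) (K N : ℕ) {P : Finset ℕ}
    (hP : P ⊆ range N) : ∑ c ∈ range (K + N + 1), q ^ c * f (insertPos K N P c) =
      qInt q (#P + K) * f P
        + ∑ p ∈ range (N + 1) \ P, q ^ threshold K P p * f (insert p P) := by
  have hN : #P ≤ N := by simpa using card_le_card hP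
  rw [range_eq_Ico, ← sum_Ico_consecutive _ (Nat.zero_le (#P + K)) (by lia),
    ← image_threshold K N hP, sum_image]
  · congr 1
    · rw [qInt, sum_mul, range_eq_Ico]
      refine sum_congr rfl fun c hc => ?_
      rw [insertPos_of_lt K N hP (mem_Ico.1 hc).2]
    · refine sum_congr rfl fun p hp => ?_
      rw [mem_sdiff, mem_range] at hp
      rw [insertPos_threshold K N hp.2 hp.1]
  · intro p hp p' hp' h
    simp only [coe_sdiff, Set.mem_sdiff, mem_coe] at hp hp'
    exact threshold_injOn K P hp.2 hp'.2 h

lemma sum_evolve_succ {R : Type*} [CommRing R] (q : R) (g K : ℕ) (v : ℕ → R)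
    (hv : ∀ H, stepNexc q g v H = qInt q K * v H) (f : Finset ℕ → R) (N : ℕ) :
    ∑ P ∈ (range (N + 1)).powerset, f P * (q ^ (∑ i ∈ P, (i + K)) * evolve q g P v (N + 1) 0) =
      ∑ P ∈ (range N).powerset, (q ^ (∑ i ∈ P, (i + K)) * evolve q g P v N 0) *
        ∑ c ∈ range (K + N + 1), q ^ c * f (insertPos K N P c) := by
  have hlast : ∀ P ∈ (range N).powerset, N ∉ P := fun P hP h => by
    simpa using mem_powerset.1 hP h
  have hmove : ∑ P ∈ (range N).powerset, ∑ p ∈ P, f P * (q ^ (∑ i ∈ P, (i + K)) *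
        (q ^ #{x ∈ P | p < x} * evolve q g (P.erase p) v N 0)) =
      ∑ P ∈ (range N).powerset, ∑ p ∈ range N \ P, (q ^ (∑ i ∈ P, (i + K)) * evolve q g P v N 0) *
        (q ^ threshold K P p * f (insert p P)) := by
    rw [sum_sigma', sum_sigma']
    refine sum_bij' (fun x _ => ⟨x.1.erase x.2, x.2⟩) (fun x _ => ⟨insert x.2 x.1, x.2⟩)
      ?_ ?_ ?_ ?_ ?_
    · rintro ⟨P, p⟩ h
      simp only [mem_sigma, mem_powerset, mem_sdiff] at h ⊢
      exact ⟨(erase_subset _ _).trans h.1, h.1 h.2, notMem_erase _ _⟩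
    · rintro ⟨P, p⟩ h
      simp only [mem_sigma, mem_powerset, mem_sdiff] at h ⊢
      exact ⟨insert_subset h.2.1 h.1, mem_insert_self _ _⟩
    · rintro ⟨P, p⟩ h
      simp only [mem_sigma] at h
      simp [insert_erase h.2]
    · rintro ⟨P, p⟩ h
      simp only [mem_sigma, mem_sdiff] at h
      simp [erase_insert h.2.2]
    · rintro ⟨P, p⟩ h
      simp only [mem_sigma] at h
      have h1 : #{x ∈ P.erase p | p < x} = #{x ∈ P | p < x} := by
        congr 1
        ext x
        simp only [mem_filter, mem_erase]
        grind
      simp only [insert_erase h.2, ← add_sum_erase P _ h.2, threshold, h1, pow_add]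
      ring
  rw [range_add_one, sum_powerset_insert notMem_range_self]
  have h1 : ∀ P ∈ (range N).powerset,
      f P * (q ^ (∑ i ∈ P, (i + K)) * evolve q g P v (N + 1) 0) =
        (q ^ (∑ i ∈ P, (i + K)) * evolve q g P v N 0) * (qInt q (#P + K) * f P) +
        ∑ p ∈ P, f P * (q ^ (∑ i ∈ P, (i + K)) *
          (q ^ #{x ∈ P | p < x} * evolve q g (P.erase p) v N 0)) := by
    intro P hP
    rw [evolve, if_neg (hlast P hP), stepNexc_evolve q g K v hv N P (mem_powerset.1 hP),
      ← mul_sum, ← mul_sum]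
    ring
  rw [sum_congr rfl h1, sum_add_distrib, hmove, ← sum_add_distrib, ← sum_add_distrib]
  refine sum_congr rfl fun P hP => ?_
  have hNP := hlast P hP
  have h0 : #{x ∈ P | N < x} = 0 := by
    rw [card_eq_zero, filter_eq_empty_iff]
    intro x hx
    have := mem_range.1 (mem_powerset.1 hP hx)
    lia
  rw [sum_insertPos q f K N (mem_powerset.1 hP), range_add_one, insert_sdiff_of_notMem _ hNP,
    sum_insert (show N ∉ range N \ P by simp), ← mul_sum, evolve, if_pos (mem_insert_self _ _),
    evolve_congr q g (P := insert N P) (P' := P) v N fun i hi => by simp [hi.ne], stepExc, sum_insert hNP,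
    threshold, h0]
  simp only [qInt_zero, qInt_succ, pow_add]
  ring

end Threshold

section RankSum

variable {R : Type*} [CommRing R]

/-- The smallest letter that makes position `i` a level excedance (0-based). -/
def exLevel (g m i : ℕ) : ℕ := g + max i m

/-- The number of possible values of the code at position `i` of a permutation with
excedance positions `Q` and excedance letters `E`. -/
def codeBound (g m n : ℕ) (Q E : Finset ℕ) (i : ℕ) : ℕ :=
  if i ∈ Q then #{j ∈ Q | j < i + 1} - #{e ∈ E | e < exLevel g m i}
  else (min (exLevel g m i) n - #{e ∈ E | e < exLevel g m i}) - (i - #{j ∈ Q | j < i})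

lemma card_filter_lt_succ (Q : Finset ℕ) (i : ℕ) :
    #{j ∈ Q | j < i + 1} = #{j ∈ Q | j < i} + if i ∈ Q then 1 else 0 := by
  split_ifs with h
  · rw [← card_insert_of_notMem (s := {j ∈ Q | j < i}) (a := i) (by simp)]
    congr 1
    ext x
    simp only [mem_filter, mem_insert]
    grind
  · rw [add_zero]
    congr 1
    ext x
    simp only [mem_filter]
    grind

lemma card_filter_lt_le (Q : Finset ℕ) (i : ℕ) : #{j ∈ Q | j < i} ≤ i := by
  simpa using card_le_card (s := {j ∈ Q | j < i}) (t := range i) fun x hx => by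
    simpa using (mem_filter.1 hx).2

lemma prod_codeBound_start (q : R) {g m n : ℕ} (hn : g + m ≤ n) (Q : Finset ℕ) (k : ℕ)
    (hk : k ≤ m) : ∏ i ∈ range k, qInt q (codeBound g m n Q ∅ i) =
      (∏ j ∈ range #{j ∈ Q | j < k}, qInt q (j + 1)) *
        ∏ j ∈ range (k - #{j ∈ Q | j < k}), qInt q (g + m - j) := by
  induction k with
  | zero => simp
  | succ k ih =>
    have hle := card_filter_lt_le Q k
    rw [prod_range_succ, ih (by lia), card_filter_lt_succ, codeBound, card_filter_lt_succ, exLevel,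
      max_eq_right (by lia), min_eq_left hn]
    split_ifs with h
    · rw [prod_range_succ, Nat.add_sub_add_right]
      simp only [filter_empty, card_empty, Nat.sub_zero]
      ring
    · rw [add_zero, Nat.sub_add_comm hle, prod_range_succ]
      simp only [filter_empty, card_empty, Nat.sub_zero]
      ring

/-- Total weight of the first `m + r` positions with `H` excedance positions left open. -/
def partialSum (q : R) (g m n : ℕ) (Q : Finset ℕ) (r H : ℕ) : R :=
  ∑ E ∈ (Ico (g + m) (g + m + r)).powerset,
    if #{j ∈ Q | j < m + r} = #E + H then ∏ i ∈ range (m + r), qInt q (codeBound g m n Q E i)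
    else 0

lemma codeBound_insert {g m n : ℕ} {Q E : Finset ℕ} {i e : ℕ} (h : exLevel g m i ≤ e) :
    codeBound g m n Q (insert e E) i = codeBound g m n Q E i := by
  have : {x ∈ insert e E | x < exLevel g m i} = {x ∈ E | x < exLevel g m i} := by
    rw [filter_insert, if_neg (by lia)]
  rw [codeBound, codeBound, this]

lemma partialSum_succ (q : R) {g m n r : ℕ} (hn : g + m + r < n) (Q : Finset ℕ) :
    partialSum q g m n Q (r + 1) =
      if m + r ∈ Q then stepExc q (partialSum q g m n Q r)
      else stepNexc q g (partialSum q g m n Q r) := by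
  ext H
  have hI : Ico (g + m) (g + m + (r + 1)) = insert (g + m + r) (Ico (g + m) (g + m + r)) := by
    ext x
    simp only [mem_Ico, mem_insert]
    lia
  rw [partialSum, hI, sum_powerset_insert (by simp), ← sum_add_distrib]
  have hins : ∀ E : Finset ℕ, ∏ i ∈ range (m + (r + 1)),
      qInt q (codeBound g m n Q (insert (g + m + r) E) i) =
        ∏ i ∈ range (m + (r + 1)), qInt q (codeBound g m n Q E i) := fun E =>
    prod_congr rfl fun i hi => by
      rw [codeBound_insert]
      have := mem_range.1 hi
      rw [exLevel]
      lia
  have hle := card_filter_lt_le Q (m + r)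
  have hE : ∀ E ∈ (Ico (g + m) (g + m + r)).powerset,
      {e ∈ E | e < exLevel g m (m + r)} = E ∧ #E ≤ r ∧ g + m + r ∉ E := by
    intro E hE
    rw [mem_powerset] at hE
    refine ⟨filter_true_of_mem fun e he => ?_, by simpa using card_le_card hE, fun h => ?_⟩
    · have := mem_Ico.1 (hE he)
      rw [exLevel]
      lia
    · simpa using hE h
  split_ifs with h
  · rw [stepExc, partialSum, partialSum, mul_sum, mul_sum, ← sum_add_distrib]
    refine sum_congr rfl fun E hE' => ?_
    obtain ⟨h1, h2, h3⟩ := hE E hE'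
    rw [hins, ← add_assoc m r 1, prod_range_succ, card_filter_lt_succ, if_pos h,
      card_insert_of_notMem h3, codeBound, if_pos h, h1, card_filter_lt_succ, if_pos h]
    generalize #{j ∈ Q | j < m + r} = s
    generalize ∏ i ∈ range (m + r), qInt q (codeBound g m n Q E i) = A
    rcases H with _ | H
    · by_cases h4 : s = #E
      · simp [h4, qInt_zero, mul_comm]
      · by_cases h5 : s + 1 = #E
        · simp [h5, qInt_zero, h4]
        · simp [h4, h5, qInt_zero]
    · by_cases h4 : s = #E + H
      · subst h4
        simp [add_assoc, mul_comm]
      · by_cases h5 : s = #E + H + 1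
        · subst h5
          have : #E + H + 1 + 1 - #E = H + 1 + 1 := by lia
          rw [this, if_neg (by lia), if_pos (by lia), if_neg (by lia), if_pos (by lia)]
          ring
        · simp only [Nat.add_sub_cancel]
          rw [if_neg (by lia), if_neg (by lia), if_neg h4, if_neg (by lia)]
          ring
  · rw [stepNexc, partialSum, partialSum, mul_sum, mul_sum, ← sum_add_distrib]
    refine sum_congr rfl fun E hE' => ?_
    obtain ⟨h1, h2, h3⟩ := hE E hE'
    rw [hins, ← add_assoc m r 1, prod_range_succ, card_filter_lt_succ, if_neg h,
      card_insert_of_notMem h3, codeBound, if_neg h, h1, exLevel, min_eq_left (by lia),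
      max_eq_left (by lia), add_zero]
    generalize hs : #{j ∈ Q | j < m + r} = s at hle ⊢
    generalize ∏ i ∈ range (m + r), qInt q (codeBound g m n Q E i) = A
    by_cases h4 : s = #E + H
    · rw [if_pos h4, if_neg (by lia), if_pos h4, if_neg (by lia),
        show g + (m + r) - #E - (m + r - s) = H + g by lia]
      ring
    · by_cases h5 : s = #E + 1 + H
      · rw [if_neg h4, if_pos h5, if_neg h4, if_pos (by lia),
          show g + (m + r) - #E - (m + r - s) = H + 1 + g by lia]
        ring
      · rw [if_neg h4, if_neg h5, if_neg h4, if_neg (by lia)]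
        ring

lemma partialSum_eq_evolve (q : R) {g m n N : ℕ} (hn : n = g + m + N) (Q P : Finset ℕ)
    (hP : ∀ i < N, i ∈ P ↔ m + i ∈ Q) (r : ℕ) (hr : r ≤ N) :
    partialSum q g m n Q r = evolve q g P (partialSum q g m n Q 0) r := by
  induction r with
  | zero => rfl
  | succ r ih =>
    rw [partialSum_succ q (by lia), evolve, ih (by lia)]
    simp only [hP r (by lia)]

lemma partialSum_zero (q : R) {g m n : ℕ} (hn : g + m ≤ n) (Q : Finset ℕ) (H : ℕ) :
    partialSum q g m n Q 0 H = if #{j ∈ Q | j < m} = H then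
      (∏ j ∈ range H, qInt q (j + 1)) * ∏ j ∈ range (m - H), qInt q (g + m - j) else 0 := by
  simp only [partialSum, add_zero, Ico_self, powerset_empty, sum_singleton, card_empty, zero_add]
  split_ifs with h
  · rw [prod_codeBound_start q hn Q m le_rfl, h]
  · rfl

lemma sum_prod_codeBound (q : R) {g m n N : ℕ} (hn : n = g + m + N) {Q : Finset ℕ}
    (hQ : Q ⊆ range (m + N)) :
    ∑ E ∈ (Ico (g + m) n).powerset with #Q = #E, ∏ i ∈ range n, qInt q (codeBound g m n Q E i) =
      partialSum q g m n Q N 0 * ∏ j ∈ range g, qInt q (g - j) := by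
  have hQ' : {j ∈ Q | j < m + N} = Q := filter_true_of_mem fun j hj => mem_range.1 (hQ hj)
  have hcard : #Q ≤ m + N := by simpa using card_le_card hQ
  rw [sum_filter, partialSum, sum_mul, hQ', ← hn]
  refine sum_congr rfl fun E hE => ?_
  rw [mem_powerset] at hE
  have hEc : #E ≤ N := by
    have := card_le_card hE
    rw [Nat.card_Ico] at this
    lia
  rw [add_zero]
  split_ifs with h
  · rw [show n = m + N + g by lia, prod_range_add, ← show n = m + N + g by lia]
    congr 1
    refine prod_congr rfl fun j hj => ?_
    have h1 : m + N + j ∉ Q := fun h => by simpa using hQ h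
    have h2 : {e ∈ E | e < exLevel g m (m + N + j)} = E := filter_true_of_mem fun e he => by
      have := mem_Ico.1 (hE he)
      rw [exLevel]
      lia
    have h3 : {i ∈ Q | i < m + N + j} = Q := filter_true_of_mem fun i hi => by
      have := mem_range.1 (hQ hi)
      lia
    rw [codeBound, if_neg h1, h2, h3, exLevel, min_eq_right (by lia)]
    congr 1
    lia
  · rw [zero_mul]

lemma evolve_sum (q : R) (g : ℕ) (P : Finset ℕ) {ι : Type*} (s : Finset ι) (c : ι → R)
    (v : ι → ℕ → R) (r : ℕ) : evolve q g P (fun H => ∑ x ∈ s, c x * v x H) r =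
      fun H => ∑ x ∈ s, c x * evolve q g P (v x) r H := by
  induction r with
  | zero => rfl
  | succ r ih =>
    ext H
    simp only [evolve, ih]
    split_ifs
    · simp only [stepExc, mul_sum, ← sum_add_distrib]
      exact sum_congr rfl fun x _ => by ring
    · simp only [stepNexc, mul_sum, ← sum_add_distrib]
      exact sum_congr rfl fun x _ => by ring

lemma sum_partialSum_zero (q : R) {g m n : ℕ} (hn : g + m ≤ n) (H : ℕ) :
    ∑ S ∈ (range m).powerset, q ^ (∑ i ∈ S, (i + g)) * partialSum q g m n S 0 H =
      initWeight q g m H := by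
  rw [initWeight, qElem, sum_mul, powersetCard_eq_filter, sum_filter]
  refine sum_congr rfl fun S hS => ?_
  have : {j ∈ S | j < m} = S := filter_true_of_mem fun j hj =>
    mem_range.1 (mem_powerset.1 hS hj)
  rw [partialSum_zero q hn, this]
  split_ifs <;> simp

/-- The positions of `Q` at or above the level `m`, counted from the level. -/
def relPos (m N : ℕ) (Q : Finset ℕ) : Finset ℕ := {i ∈ range N | m + i ∈ Q}

lemma sum_sum_prod_codeBound (q : R) {g m n N : ℕ} (hn : n = g + m + N) (f : Finset ℕ → R) :
    ∑ Q ∈ (range (m + N)).powerset, ∑ E ∈ (Ico (g + m) n).powerset with #Q = #E,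
      f (relPos m N Q) * q ^ (∑ i ∈ Q, (i + g)) *
        ∏ i ∈ range n, qInt q (codeBound g m n Q E i) =
    (∑ P ∈ (range N).powerset, f P * (q ^ (∑ i ∈ P, (i + (g + m))) *
        evolve q g P (initWeight q g m) N 0)) * ∏ j ∈ range g, qInt q (g - j) := by
  have hdisj : ∀ S ⊆ range m, ∀ P : Finset ℕ, Disjoint S (P.map (addLeftEmbedding m)) := by
    intro S hS P
    rw [disjoint_left]
    intro x hx hx'
    obtain ⟨y, -, rfl⟩ := mem_map.1 hx'
    simpa using hS hx
  have hrel : ∀ S ⊆ range m, ∀ P ⊆ range N,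
      relPos m N (S ∪ P.map (addLeftEmbedding m)) = P := by
    intro S hS P hP
    ext x
    simp only [relPos, mem_filter, mem_union, mem_map, addLeftEmbedding_apply, mem_range,
      add_right_inj, exists_eq_right]
    constructor
    · rintro ⟨-, h | h⟩
      · simpa using hS h
      · exact h
    · exact fun h => ⟨mem_range.1 (hP h), .inr h⟩
  have h1 : ∀ Q ∈ (range (m + N)).powerset, ∑ E ∈ (Ico (g + m) n).powerset with #Q = #E,
      f (relPos m N Q) * q ^ (∑ i ∈ Q, (i + g)) *
        ∏ i ∈ range n, qInt q (codeBound g m n Q E i) =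
      f (relPos m N Q) * q ^ (∑ i ∈ Q, (i + g)) * partialSum q g m n Q N 0 *
        ∏ j ∈ range g, qInt q (g - j) := by
    intro Q hQ
    rw [← mul_sum, sum_prod_codeBound q hn (mem_powerset.1 hQ), ← mul_assoc]
  rw [sum_congr rfl h1, ← sum_mul]
  congr 1
  have h2 : ∑ Q ∈ (range (m + N)).powerset,
      f (relPos m N Q) * q ^ (∑ i ∈ Q, (i + g)) * partialSum q g m n Q N 0 =
      ∑ x ∈ (range N).powerset ×ˢ (range m).powerset,
        f x.1 * (q ^ (∑ i ∈ x.1, (i + (g + m))) * (q ^ (∑ i ∈ x.2, (i + g)) *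
          evolve q g x.1 (partialSum q g m n x.2 0) N 0)) := by
    symm
    refine sum_bij' (fun x _ => x.2 ∪ x.1.map (addLeftEmbedding m))
      (fun Q _ => (relPos m N Q, {j ∈ Q | j < m})) ?_ ?_ ?_ ?_ ?_
    · rintro ⟨P, S⟩ h
      simp only [mem_product, mem_powerset] at h ⊢
      refine union_subset (h.2.trans (range_subset_range.2 (by lia))) fun x hx => ?_
      obtain ⟨y, hy, rfl⟩ := mem_map.1 hx
      simpa using h.1 hy
    · intro Q hQ
      simp only [mem_product, mem_powerset]
      refine ⟨filter_subset _ _, fun x hx => mem_range.2 (mem_filter.1 hx).2⟩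
    · rintro ⟨P, S⟩ h
      simp only [mem_product, mem_powerset] at h
      rw [hrel S h.2 P h.1]
      congr 1
      ext x
      simp only [mem_filter, mem_union, mem_map, addLeftEmbedding_apply]
      constructor
      · rintro ⟨h' | ⟨y, -, rfl⟩, h''⟩
        · exact h'
        · lia
      · exact fun h' => ⟨.inl h', mem_range.1 (h.2 h')⟩
    · intro Q hQ
      ext x
      simp only [relPos, mem_filter, mem_union, mem_map, addLeftEmbedding_apply, mem_range]
      constructor
      · rintro (h | ⟨y, h, rfl⟩)
        · exact h.1
        · exact h.2
      · intro h
        have := mem_range.1 (mem_powerset.1 hQ h)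
        rcases lt_or_ge x m with hx | hx
        · exact .inl ⟨h, hx⟩
        · exact .inr ⟨x - m, ⟨by lia, by rwa [Nat.add_sub_cancel' hx]⟩, by lia⟩
    · rintro ⟨P, S⟩ h
      simp only [mem_product, mem_powerset] at h
      have h3 : partialSum q g m n (S ∪ P.map (addLeftEmbedding m)) 0 =
          partialSum q g m n S 0 := by
        ext H
        rw [partialSum_zero q (by lia), partialSum_zero q (by lia)]
        congr 3
        ext x
        simp only [mem_filter, mem_union, mem_map, addLeftEmbedding_apply]
        constructor
        · rintro ⟨h' | ⟨y, -, rfl⟩, h''⟩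
          · exact ⟨h', h''⟩
          · lia
        · exact fun h' => ⟨.inl h'.1, h'.2⟩
      have h4 := hrel S h.2 P h.1
      rw [partialSum_eq_evolve q hn (S ∪ P.map (addLeftEmbedding m)) P (fun i hi => by
          rw [← h4, relPos]; simp [hi]) N le_rfl, h3, h4, sum_union (hdisj S h.2 P), sum_map]
      simp only [addLeftEmbedding_apply, pow_add, show ∀ i, m + i + g = i + (g + m) by intro; ring]
      ring
  rw [h2, sum_product]
  refine sum_congr rfl fun P _ => ?_
  have h5 : initWeight q g m = fun H => ∑ S ∈ (range m).powerset,
      q ^ (∑ i ∈ S, (i + g)) * partialSum q g m n S 0 H :=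
    funext fun H => (sum_partialSum_zero q (by lia) H).symm
  rw [h5, evolve_sum]
  dsimp only
  rw [← mul_sum, ← mul_sum]

end RankSum

section Code

variable {n : ℕ}

/-- The positions `i` with `σ_i` at least the level `exLevel g m i`. -/
def levelPos (g m : ℕ) (σ : Equiv.Perm (Fin n)) : Finset (Fin n) :=
  univ.filter fun i => exLevel g m i ≤ σ i

/-- The positions of `levelPos`, as natural numbers. -/
def posSet (g m : ℕ) (σ : Equiv.Perm (Fin n)) : Finset ℕ := (levelPos g m σ).map Fin.valEmbedding

/-- The letters at the positions of `levelPos`, as natural numbers. -/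
def letterSet (g m : ℕ) (σ : Equiv.Perm (Fin n)) : Finset ℕ :=
  (levelPos g m σ).map (σ.toEmbedding.trans Fin.valEmbedding)

/-- Inversions ending at an excedance position, or starting at a non-excedance position, within
the respective subsequence. -/
def invCode (g m : ℕ) (σ : Equiv.Perm (Fin n)) (i : Fin n) : ℕ :=
  if i ∈ levelPos g m σ then #{j ∈ levelPos g m σ | j < i ∧ σ i < σ j}
  else #{j : Fin n | j ∉ levelPos g m σ ∧ i < j ∧ σ j < σ i}

lemma mem_levelPos {g m : ℕ} {σ : Equiv.Perm (Fin n)} {i : Fin n} :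
    i ∈ levelPos g m σ ↔ exLevel g m i ≤ σ i := by
  simp [levelPos]

lemma mem_posSet {g m : ℕ} {σ : Equiv.Perm (Fin n)} {i : Fin n} :
    (i : ℕ) ∈ posSet g m σ ↔ i ∈ levelPos g m σ := by
  simp [posSet, Fin.val_inj]

lemma exLevel_mono (g m : ℕ) : Monotone (exLevel g m) := fun i j h => by
  simp only [exLevel]
  lia

lemma card_posSet_filter (g m : ℕ) (σ : Equiv.Perm (Fin n)) (k : ℕ) :
    #{j ∈ posSet g m σ | j < k} = #((levelPos g m σ).filter fun j : Fin n => (j : ℕ) < k) := by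
  rw [posSet, filter_map, card_map]
  rfl

lemma card_letterSet_filter (g m : ℕ) (σ : Equiv.Perm (Fin n)) (k : ℕ) :
    #{e ∈ letterSet g m σ | e < k} = #{j ∈ levelPos g m σ | (σ j : ℕ) < k} := by
  rw [letterSet, filter_map, card_map]
  rfl

lemma card_val_lt (k : ℕ) : #{j : Fin n | (j : ℕ) < k} = min k n := by
  rw [← card_map Fin.valEmbedding, show map Fin.valEmbedding {j : Fin n | (j : ℕ) < k} =
    range (min k n) by
      ext x
      simp only [mem_map, mem_filter, mem_univ, true_and, Fin.valEmbedding_apply, mem_range]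
      exact ⟨by rintro ⟨j, hj, rfl⟩; lia, fun h => ⟨⟨x, by lia⟩, by simp; lia⟩⟩, card_range]

lemma card_perm_lt (σ : Equiv.Perm (Fin n)) (k : ℕ) : #{j | (σ j : ℕ) < k} = min k n := by
  rw [← card_val_lt, ← card_map σ.toEmbedding]
  congr 1
  ext x
  simp only [mem_map, mem_filter, mem_univ, true_and, Equiv.toEmbedding_apply]
  exact ⟨by rintro ⟨j, hj, rfl⟩; exact hj, fun h => ⟨σ.symm x, by simpa using h⟩⟩

lemma invCode_lt (g m : ℕ) (σ : Equiv.Perm (Fin n)) (i : Fin n) :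
    invCode g m σ i < codeBound g m n (posSet g m σ) (letterSet g m σ) i := by
  have hmono := exLevel_mono g m
  rw [codeBound, card_letterSet_filter, card_posSet_filter, card_posSet_filter]
  simp only [mem_posSet, invCode]
  split_ifs with h
  · have h1 : #{j ∈ levelPos g m σ | j < i ∧ σ i < σ j} +
        #{j ∈ levelPos g m σ | (σ j : ℕ) < exLevel g m i} + #{i} ≤
        #((levelPos g m σ).filter fun j : Fin n => (j : ℕ) < i + 1) := by
      rw [← card_union_of_disjoint, ← card_union_of_disjoint]
      · refine card_le_card fun j hj => ?_
        simp only [mem_union, mem_filter, mem_singleton] at hj ⊢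
        rcases hj with (hj | hj) | rfl
        · exact ⟨hj.1, by have := hj.2.1; lia⟩
        · refine ⟨hj.1, ?_⟩
          by_contra! hlt
          have := hmono (show (i : ℕ) ≤ j by lia)
          have := mem_levelPos.1 hj.1
          lia
        · exact ⟨h, by lia⟩
      · rw [disjoint_singleton_right]
        have := mem_levelPos.1 h
        simp only [mem_union, mem_filter]
        lia
      · rw [disjoint_left]
        have := mem_levelPos.1 h
        simp only [mem_filter, Fin.lt_def]
        lia
    rw [card_singleton] at h1
    lia
  · have h0 : #((levelPos g m σ).filter fun j : Fin n => (j : ℕ) < i) +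
        #{j : Fin n | j ∉ levelPos g m σ ∧ (j : ℕ) < i} = i := by
      rw [← card_union_of_disjoint]
      · have := card_val_lt (n := n) i
        rw [min_eq_left (by lia)] at this
        conv_rhs => rw [← this]
        congr 1
        ext j
        simp only [mem_union, mem_filter, mem_univ, true_and]
        tauto
      · rw [disjoint_left]
        simp only [mem_filter, mem_univ, true_and]
        tauto
    have h1 : #{j : Fin n | j ∉ levelPos g m σ ∧ i < j ∧ σ j < σ i} +
        #{j ∈ levelPos g m σ | (σ j : ℕ) < exLevel g m i} +
        #{j : Fin n | j ∉ levelPos g m σ ∧ (j : ℕ) < i} + #{i} ≤ min (exLevel g m i) n := by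
      rw [← card_perm_lt σ, ← card_union_of_disjoint, ← card_union_of_disjoint,
        ← card_union_of_disjoint]
      · have hi := mem_levelPos.not.1 h
        refine card_le_card fun j hj => ?_
        simp only [mem_union, mem_filter, mem_singleton, mem_univ, true_and, Fin.lt_def] at hj ⊢
        rcases hj with ((hj | hj) | hj) | rfl
        · lia
        · exact hj.2
        · have := hmono hj.2.le
          have := mem_levelPos.not.1 hj.1
          lia
        · lia
      · rw [disjoint_singleton_right]
        simp only [mem_union, mem_filter, mem_univ, true_and, h, lt_self_iff_false]
        tauto
      · rw [disjoint_left]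
        simp only [mem_union, mem_filter, mem_univ, true_and, Fin.lt_def]
        rintro j (hj | hj) hj'
        · lia
        · exact hj'.1 hj.1
      · rw [disjoint_left]
        simp only [mem_filter, mem_univ, true_and]
        tauto
    rw [card_singleton] at h1
    lia

lemma posSet_subset (g m : ℕ) {N : ℕ} (hn : n = g + m + N) (σ : Equiv.Perm (Fin n)) :
    posSet g m σ ⊆ range (m + N) := fun x hx => by
  obtain ⟨i, hi, rfl⟩ := mem_map.1 hx
  have := mem_levelPos.1 hi
  have := (σ i).isLt
  simp only [exLevel] at *
  simp only [Fin.valEmbedding_apply, mem_range]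
  lia

lemma letterSet_subset (g m : ℕ) (σ : Equiv.Perm (Fin n)) :
    letterSet g m σ ⊆ Ico (g + m) n := fun x hx => by
  obtain ⟨i, hi, rfl⟩ := mem_map.1 hx
  have := mem_levelPos.1 hi
  simp only [exLevel] at this
  simp only [Function.Embedding.trans_apply, Equiv.toEmbedding_apply, Fin.valEmbedding_apply,
    mem_Ico]
  lia

lemma not_lt_of_invCode_eq_of_mem {g m : ℕ} {σ τ : Equiv.Perm (Fin n)}
    (hQ : levelPos g m σ = levelPos g m τ) (hE : letterSet g m σ = letterSet g m τ) {i : Fin n}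
    (hi : i ∈ levelPos g m σ) (hc : invCode g m σ i = invCode g m τ i)
    (hlt : ∀ j ∈ levelPos g m σ, i < j → σ j = τ j) : ¬ σ i < τ i := by
  intro h
  have hmem : ∀ j ∈ levelPos g m σ, ∃ k ∈ levelPos g m σ, σ k = τ j := by
    intro j hj
    have : (τ j : ℕ) ∈ letterSet g m τ := mem_map.2 ⟨j, hQ ▸ hj, rfl⟩
    rw [← hE] at this
    obtain ⟨k, hk, hk'⟩ := mem_map.1 this
    exact ⟨k, hk, Fin.ext hk'⟩
  have hkey : ∀ j ∈ levelPos g m σ, j ≤ i → τ i ≤ τ j →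
      ∃ k ∈ levelPos g m σ, (k < i ∧ σ i < σ k) ∧ σ k = τ j := by
    intro j hj hji hle
    obtain ⟨k, hk, hkj⟩ := hmem j hj
    refine ⟨k, hk, ⟨?_, hkj ▸ h.trans_le hle⟩, hkj⟩
    by_contra! hik
    rcases hik.eq_or_lt with rfl | hik
    · exact (h.trans_le hle).ne hkj
    · have := τ.injective ((hlt k hk hik).symm.trans hkj)
      lia
  rw [invCode, invCode, if_pos hi, if_pos (hQ ▸ hi), ← hQ] at hc
  refine absurd hc (Nat.ne_of_gt (Nat.add_one_le_iff.1 ?_))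
  rw [← card_insert_of_notMem (a := i) (by simp)]
  refine (card_map τ.toEmbedding).symm.trans_le
    ((card_le_card fun x hx => ?_).trans_eq (card_map σ.toEmbedding))
  obtain ⟨j, hj, rfl⟩ := mem_map.1 hx
  rw [mem_insert, mem_filter] at hj
  obtain ⟨k, hk, hk', hkj⟩ : ∃ k ∈ levelPos g m σ, (k < i ∧ σ i < σ k) ∧ σ k = τ j := by
    rcases hj with rfl | hj
    · exact hkey j hi le_rfl le_rfl
    · exact hkey j hj.1 hj.2.1.le hj.2.2.le
  exact mem_map.2 ⟨k, mem_filter.2 ⟨hk, hk'⟩, hkj⟩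

lemma not_lt_of_invCode_eq_of_notMem {g m : ℕ} {σ τ : Equiv.Perm (Fin n)}
    (hQ : levelPos g m σ = levelPos g m τ) {i : Fin n}
    (hi : i ∉ levelPos g m σ) (hc : invCode g m σ i = invCode g m τ i)
    (hmem : ∀ j ∈ levelPos g m σ, σ j = τ j) (hlt : ∀ j < i, σ j = τ j) : ¬ σ i < τ i := by
  intro h
  have hkey : ∀ j, j ∉ levelPos g m σ → i ≤ j → σ j ≤ σ i →
      ∃ k, (k ∉ levelPos g m σ ∧ i < k ∧ τ k < τ i) ∧ τ k = σ j := by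
    intro j hj hij hle
    have hk : τ (τ.symm (σ j)) = σ j := by simp
    generalize τ.symm (σ j) = k at hk
    refine ⟨k, ⟨fun hk' => ?_, ?_, hk ▸ hle.trans_lt h⟩, hk⟩
    · have := σ.injective ((hmem k hk').trans hk)
      exact hj (this ▸ hk')
    · by_contra! hki
      rcases hki.eq_or_lt with rfl | hki
      · exact (hle.trans_lt h).ne' hk
      · have := σ.injective ((hlt k hki).trans hk)
        lia
  rw [invCode, invCode, if_neg hi, if_neg (hQ ▸ hi), ← hQ] at hc
  refine absurd hc (Nat.ne_of_lt (Nat.add_one_le_iff.1 ?_))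
  rw [← card_insert_of_notMem (a := i) (by simp)]
  refine (card_map σ.toEmbedding).symm.trans_le
    ((card_le_card fun x hx => ?_).trans_eq (card_map τ.toEmbedding))
  obtain ⟨j, hj, rfl⟩ := mem_map.1 hx
  rw [mem_insert, mem_filter] at hj
  obtain ⟨k, hk, hkj⟩ : ∃ k, (k ∉ levelPos g m σ ∧ i < k ∧ τ k < τ i) ∧ τ k = σ j := by
    rcases hj with rfl | hj
    · exact hkey j hi le_rfl le_rfl
    · exact hkey j hj.2.1 hj.2.2.1.le hj.2.2.2.le
  exact mem_map.2 ⟨k, by simpa using hk, hkj⟩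

lemma eq_of_invCode_eq {g m : ℕ} {σ τ : Equiv.Perm (Fin n)} (hQ : posSet g m σ = posSet g m τ)
    (hE : letterSet g m σ = letterSet g m τ) (hc : invCode g m σ = invCode g m τ) : σ = τ := by
  have hQ : levelPos g m σ = levelPos g m τ := map_injective _ hQ
  have hmem : ∀ i ∈ levelPos g m σ, σ i = τ i := by
    intro i
    induction i using WellFoundedGT.induction with
    | ind i ih =>
      intro hi
      have h1 := not_lt_of_invCode_eq_of_mem hQ hE hi (congrFun hc i) fun j hj hij => ih j hij hj
      have h2 := not_lt_of_invCode_eq_of_mem hQ.symm hE.symm (hQ ▸ hi) (congrFun hc i).symm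
        fun j hj hij => (ih j hij (hQ ▸ hj)).symm
      exact le_antisymm (not_lt.1 h2) (not_lt.1 h1)
  ext i
  congr 1
  induction i using WellFoundedLT.induction with
  | ind i ih =>
    by_cases hi : i ∈ levelPos g m σ
    · exact hmem i hi
    have h1 := not_lt_of_invCode_eq_of_notMem hQ hi (congrFun hc i) hmem ih
    have h2 := not_lt_of_invCode_eq_of_notMem hQ.symm (hQ ▸ hi) (congrFun hc i).symm
      (fun j hj => (hmem j (hQ ▸ hj)).symm) fun j hj => (ih j hj).symm
    exact le_antisymm (not_lt.1 h2) (not_lt.1 h1)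

lemma sum_invCode (g m : ℕ) (σ : Equiv.Perm (Fin n)) :
    ∑ i, invCode g m σ i =
      invOn σ (fun i => i ∈ levelPos g m σ) + invOn σ (fun i => i ∉ levelPos g m σ) := by
  have h1 : invOn σ (fun i => i ∈ levelPos g m σ) =
      ∑ i, if i ∈ levelPos g m σ then #{j ∈ levelPos g m σ | j < i ∧ σ i < σ j} else 0 := by
    rw [invOn, card_filter, ← univ_product_univ, sum_product_right]
    refine sum_congr rfl fun i _ => ?_
    rw [← card_filter]
    split_ifs with h
    · congr 1
      ext j
      simp only [mem_filter, mem_univ, true_and, val1, h, Fin.lt_def]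
      lia
    · rw [card_eq_zero, filter_eq_empty_iff]
      tauto
  have h2 : invOn σ (fun i => i ∉ levelPos g m σ) =
      ∑ i, if i ∈ levelPos g m σ then 0
        else #{j : Fin n | j ∉ levelPos g m σ ∧ i < j ∧ σ j < σ i} := by
    rw [invOn, card_filter, ← univ_product_univ, sum_product]
    refine sum_congr rfl fun i _ => ?_
    rw [← card_filter]
    split_ifs with h
    · rw [card_eq_zero, filter_eq_empty_iff]
      tauto
    · congr 1
      ext j
      simp only [mem_filter, mem_univ, true_and, val1, h, Fin.lt_def]
      lia
  rw [h1, h2, ← sum_add_distrib]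
  refine sum_congr rfl fun i _ => ?_
  rw [invCode]
  split_ifs <;> simp

lemma gden_eq (g h : ℕ) (σ : Equiv.Perm (Fin n)) :
    gden g h σ = ∑ i ∈ posSet g (h - 1 - g) σ, (i + g) + ∑ i, invCode g (h - 1 - g) σ i := by
  have hiff : ∀ i, (pos1 i + g ≤ val1 σ i ∧ h ≤ val1 σ i) ↔ i ∈ levelPos g (h - 1 - g) σ := by
    intro i
    rw [mem_levelPos, exLevel, pos1, val1]
    lia
  rw [sum_invCode, gden, posSet, sum_map, ← add_assoc]
  simp only [hiff, filter_mem_eq_inter, univ_inter, Fin.valEmbedding_apply]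
  simp only [pos1]
  congr 2
  exact sum_congr rfl fun i _ => by lia

end Code

section GeneratingFunction

variable {R : Type*} [CommRing R]

/-- The generating function of Denert's statistic over permutations, weighted by a function of
the positions of the level excedances and computed by the transfer operators. -/
def genFun (q : R) (g m N : ℕ) (f : Finset ℕ → R) : R :=
  (∑ P ∈ (range N).powerset, f P * (q ^ (∑ i ∈ P, (i + (g + m))) *
    evolve q g P (initWeight q g m) N 0)) * ∏ j ∈ range g, qInt q (g - j)

lemma genFun_succ (q : R) (g m N : ℕ) (f : Finset ℕ → R) : genFun q g m (N + 1) f =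
    genFun q g m N fun P => ∑ c ∈ range (g + m + N + 1), q ^ c * f (insertPos (g + m) N P c) := by
  rw [genFun, genFun, sum_evolve_succ q g _ _ (stepNexc_initWeight q g m)]
  simp only [mul_comm]

lemma genFun_const_mul (q : R) (g m N : ℕ) (a : R) (f : Finset ℕ → R) :
    genFun q g m N (fun P => a * f P) = a * genFun q g m N f := by
  simp only [genFun, mul_sum, sum_mul, mul_assoc]

lemma genFun_zero (q : R) (g m : ℕ) (f : Finset ℕ → R) :
    genFun q g m 0 f = f ∅ * ∏ j ∈ range (g + m), qInt q (j + 1) := by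
  have h : ∏ j ∈ range (m + g), qInt q (g + m - j) = ∏ j ∈ range (g + m), qInt q (j + 1) := by
    rw [add_comm m g, ← prod_range_reflect]
    exact prod_congr rfl fun j hj => by
      have := mem_range.1 hj
      congr 1
      lia
  simp only [genFun, range_zero, powerset_empty, sum_singleton, sum_empty, pow_zero, one_mul,
    evolve, initWeight, qElem, powersetCard_zero, prod_empty, Nat.sub_zero]
  rw [← h, prod_range_add, mul_assoc]
  congr 2
  exact prod_congr rfl fun j hj => by
    congr 1
    lia

lemma genFun_one_one (g m N : ℕ) :
    genFun (1 : ℤ) g m N (fun _ => 1) = (g + m + N).factorial := by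
  induction N with
  | zero =>
    rw [genFun_zero, add_zero, ← prod_range_add_one_eq_factorial]
    push_cast
    simp [qInt]
  | succ N ih =>
    rw [genFun_succ, ← add_assoc, Nat.factorial_succ, Nat.cast_mul, ← ih, ← genFun_const_mul]
    simp

/-- Triples of positions, letters and admissible codes. -/
def codeSet (g m n N : ℕ) : Finset (Σ _ : Finset ℕ, Σ _ : Finset ℕ, (Fin n → ℕ)) :=
  (range (m + N)).powerset.sigma fun Q =>
    ((Ico (g + m) n).powerset.filter fun E => #Q = #E).sigma fun E =>
      Fintype.piFinset fun i : Fin n => range (codeBound g m n Q E i)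

lemma sum_codeSet (q : R) {g m n N : ℕ} (hn : n = g + m + N) (f : Finset ℕ → R) :
    ∑ x ∈ codeSet g m n N, f (relPos m N x.1) * q ^ (∑ i ∈ x.1, (i + g) + ∑ i, x.2.2 i) =
      genFun q g m N f := by
  rw [genFun, ← sum_sum_prod_codeBound q hn, codeSet, sum_sigma]
  refine sum_congr rfl fun Q _ => ?_
  rw [sum_sigma]
  refine sum_congr rfl fun E _ => ?_
  simp only [pow_add, ← mul_assoc]
  rw [← mul_sum, ← Fin.prod_univ_eq_prod_range (fun i => qInt q (codeBound g m n Q E i))]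
  simp only [qInt, prod_univ_sum, prod_pow_eq_pow_sum]

/-- The position set, letter set and code of a permutation. -/
def toCode (g m : ℕ) {n : ℕ} (σ : Equiv.Perm (Fin n)) :
    Σ _ : Finset ℕ, Σ _ : Finset ℕ, (Fin n → ℕ) :=
  ⟨posSet g m σ, letterSet g m σ, invCode g m σ⟩

lemma toCode_injective (g m n : ℕ) : Function.Injective (toCode g m (n := n)) := fun σ τ h => by
  simp only [toCode, Sigma.mk.injEq, heq_eq_eq] at h
  exact eq_of_invCode_eq h.1 h.2.1 h.2.2

lemma image_toCode {g m n N : ℕ} (hn : n = g + m + N) :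
    univ.image (toCode g m (n := n)) = codeSet g m n N := by
  refine eq_of_subset_of_card_le (fun x hx => ?_) ?_
  · obtain ⟨σ, -, rfl⟩ := mem_image.1 hx
    simp only [toCode, codeSet, mem_sigma, mem_powerset, mem_filter, Fintype.mem_piFinset,
      mem_range]
    refine ⟨posSet_subset g m hn σ, ⟨letterSet_subset g m σ, ?_⟩, invCode_lt g m σ⟩
    rw [posSet, letterSet, card_map, card_map]
  · rw [card_image_of_injective _ (toCode_injective g m n), card_univ, Fintype.card_perm,
      Fintype.card_fin]
    have h := sum_codeSet (1 : ℤ) hn fun _ => 1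
    rw [genFun_one_one, ← hn] at h
    simp only [one_pow, mul_one, sum_const, nsmul_eq_mul] at h
    exact_mod_cast h.le

lemma sum_perm_pow (q : R) {g m n N : ℕ} (hn : n = g + m + N) (f : Finset ℕ → R) :
    ∑ σ : Equiv.Perm (Fin n), f (relPos m N (posSet g m σ)) *
      q ^ (∑ i ∈ posSet g m σ, (i + g) + ∑ i, invCode g m σ i) = genFun q g m N f := by
  rw [← sum_codeSet q hn, ← image_toCode hn,
    sum_image fun _ _ _ _ h => toCode_injective g m n h]
  rfl

end GeneratingFunction

section Bijection

lemma sum_perm_succ {R : Type*} [CommRing R] (q : R) {g m n N : ℕ} (hn : n = g + m + N)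
    (f : Finset ℕ → R) :
    ∑ σ : Equiv.Perm (Fin (n + 1)), f (relPos m (N + 1) (posSet g m σ)) *
      q ^ (∑ i ∈ posSet g m σ, (i + g) + ∑ i, invCode g m σ i) =
    ∑ x : Equiv.Perm (Fin n) × Fin (n + 1),
      f (insertPos (g + m) N (relPos m N (posSet g m x.1)) x.2) *
        q ^ (∑ i ∈ posSet g m x.1, (i + g) + ∑ i, invCode g m x.1 i + x.2) := by
  rw [sum_perm_pow q (N := N + 1) (by lia), genFun_succ, ← sum_perm_pow q hn, ← hn,
    ← univ_product_univ, sum_product]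
  refine sum_congr rfl fun σ _ => ?_
  rw [sum_mul, ← Fin.sum_univ_eq_sum_range (fun c => q ^ c *
    f (insertPos (g + m) N (relPos m N (posSet g m σ)) c) *
      q ^ (∑ i ∈ posSet g m σ, (i + g) + ∑ i, invCode g m σ i))]
  exact sum_congr rfl fun c _ => by ring

lemma exists_bijective_of_card_fiber {α β γ : Type*} [Fintype α] [Fintype β] [DecidableEq γ]
    (u : α → γ) (v : β → γ) (h : ∀ c, #{a | u a = c} = #{b | v b = c}) :
    ∃ φ : α → β, Function.Bijective φ ∧ ∀ a, v (φ a) = u a := by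
  have e : ∀ c, {a // u a = c} ≃ {b // v b = c} := fun c => Fintype.equivOfCardEq (by
    rw [Fintype.card_subtype, Fintype.card_subtype, h])
  exact ⟨Equiv.ofFiberEquiv e, (Equiv.ofFiberEquiv e).bijective, Equiv.ofFiberEquiv_map e⟩

lemma card_fiber_eq_of_sum_pow_eq {α β γ : Type*} [Fintype α] [Fintype β] [DecidableEq γ]
    (u : α → γ) (v : β → γ) (d : α → ℕ) (e : β → ℕ)
    (h : ∀ f : γ → Polynomial ℤ, ∑ a, f (u a) * Polynomial.X ^ d a =
      ∑ b, f (v b) * Polynomial.X ^ e b) (c : γ × ℕ) :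
    #{a | (u a, d a) = c} = #{b | (v b, e b) = c} := by
  have h1 := congrArg (Polynomial.coeff · c.2) (h fun x => if x = c.1 then 1 else 0)
  simp only [ite_mul, one_mul, zero_mul, Polynomial.finsetSum_coeff,
    apply_ite (Polynomial.coeff · c.2), Polynomial.coeff_X_pow, Polynomial.coeff_zero] at h1
  rw [← Nat.cast_inj (R := ℤ), card_filter, card_filter]
  push_cast
  refine (sum_congr rfl fun a _ => ?_).trans (h1.trans (sum_congr rfl fun b _ => ?_)) <;>
    simp only [Prod.ext_iff] <;> grind

lemma exists_bijection_posSet {g m n N : ℕ} (hn : n = g + m + N) :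
    ∃ φ : Equiv.Perm (Fin n) × Fin (n + 1) → Equiv.Perm (Fin (n + 1)), Function.Bijective φ ∧
      ∀ x, relPos m (N + 1) (posSet g m (φ x)) =
          insertPos (g + m) N (relPos m N (posSet g m x.1)) x.2 ∧
        ∑ i ∈ posSet g m (φ x), (i + g) + ∑ i, invCode g m (φ x) i =
          ∑ i ∈ posSet g m x.1, (i + g) + ∑ i, invCode g m x.1 i + x.2 := by
  obtain ⟨φ, hφ, h⟩ := exists_bijective_of_card_fiber _ _ (card_fiber_eq_of_sum_pow_eq
    (fun x : Equiv.Perm (Fin n) × Fin (n + 1) =>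
      insertPos (g + m) N (relPos m N (posSet g m x.1)) x.2)
    (fun σ : Equiv.Perm (Fin (n + 1)) => relPos m (N + 1) (posSet g m σ)) _ _
    fun f => (sum_perm_succ Polynomial.X hn f).symm)
  exact ⟨φ, hφ, fun x => Prod.ext_iff.1 (h x)⟩

lemma relPos_subset (m N : ℕ) (Q : Finset ℕ) : relPos m N Q ⊆ range N := filter_subset _ _

lemma gexc_eq {g h n N : ℕ} (hn : n = g + (h - 1 - g) + N) (σ : Equiv.Perm (Fin n)) {l : ℕ}
    (hl : 1 ≤ l) (hgl : h ≤ g + l) : gexc g l σ =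
      #{x ∈ relPos (h - 1 - g) N (posSet g (h - 1 - g) σ) | l - 1 - (h - 1 - g) ≤ x} := by
  set m := h - 1 - g with hm
  symm
  rw [← card_map (addLeftEmbedding m), gexc, ← card_map Fin.valEmbedding (s := univ.filter _)]
  congr 1
  ext x
  simp only [mem_map, mem_filter, relPos, mem_range, addLeftEmbedding_apply, mem_univ, true_and,
    Fin.valEmbedding_apply]
  simp only [pos1, val1]
  constructor
  · rintro ⟨r, ⟨⟨hr, hmem⟩, hlr⟩, rfl⟩
    obtain ⟨i, hi, hi'⟩ := mem_map.1 hmem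
    have := mem_levelPos.1 hi
    simp only [Fin.valEmbedding_apply] at hi'
    simp only [exLevel] at this
    exact ⟨i, by lia, hi'⟩
  · rintro ⟨i, hi, rfl⟩
    have := (σ i).isLt
    have h1 : i ∈ levelPos g m σ := by
      rw [mem_levelPos, exLevel]
      lia
    refine ⟨i - m, ⟨⟨by lia, ?_⟩, by lia⟩, by lia⟩
    rw [Nat.add_sub_cancel' (by lia)]
    exact mem_posSet.2 h1

lemma gexc_eq_zero {g n : ℕ} (hn : n ≤ g) (l : ℕ) (σ : Equiv.Perm (Fin n)) : gexc g l σ = 0 := by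
  rw [gexc, card_eq_zero, filter_eq_empty_iff]
  intro i _
  have := (σ i).isLt
  simp only [pos1, val1]
  lia

lemma gden_eq_of_le {g n : ℕ} (hn : n ≤ g) (h : ℕ) (σ : Equiv.Perm (Fin n)) :
    gden g h σ = gden n 1 σ := by
  have h1 : ∀ i, (pos1 i + g ≤ val1 σ i ∧ h ≤ val1 σ i) ↔ False := fun i => by
    have := (σ i).isLt
    simp only [pos1, val1]
    lia
  have h2 : ∀ i, (pos1 i + n ≤ val1 σ i ∧ 1 ≤ val1 σ i) ↔ False := fun i => by
    have := (σ i).isLt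
    simp only [pos1, val1]
    lia
  simp only [gden, h1, h2, filter_false, sum_empty]

lemma sum_pow_gden_of_le {R : Type*} [CommRing R] (q : R) {g n : ℕ} (hn : n ≤ g) (h : ℕ) :
    ∑ σ : Equiv.Perm (Fin n), q ^ gden g h σ = ∏ j ∈ range n, qInt q (j + 1) := by
  have := sum_perm_pow q (n := n) (g := n) (m := 0) (N := 0) rfl fun _ => 1
  rw [genFun_zero, one_mul] at this
  simpa only [gden_eq_of_le hn h, gden_eq n 1, one_mul, Nat.sub_self, Nat.zero_sub, add_zero] using this

lemma exists_bijection_gden_of_le {g n : ℕ} (hn : n + 1 ≤ g) (h : ℕ) :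
    ∃ φ : Equiv.Perm (Fin n) × Fin (n + 1) → Equiv.Perm (Fin (n + 1)), Function.Bijective φ ∧
      ∀ x, gden g h (φ x) = gden g h x.1 + x.2 := by
  obtain ⟨φ, hφ, h⟩ := exists_bijective_of_card_fiber _ _ (card_fiber_eq_of_sum_pow_eq
    (fun _ : Equiv.Perm (Fin n) × Fin (n + 1) => ())
    (fun _ : Equiv.Perm (Fin (n + 1)) => ()) (fun x => gden g h x.1 + x.2) (gden g h)
    fun f => by
      rw [← mul_sum, ← mul_sum, sum_pow_gden_of_le _ hn, prod_range_succ,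
        ← sum_pow_gden_of_le _ (by lia : n ≤ g) h, qInt, ← univ_product_univ, sum_product,
        ← Fin.sum_univ_eq_sum_range, sum_mul_sum]
      simp only [pow_add])
  exact ⟨φ, hφ, fun x => (Prod.ext_iff.1 (h x)).2⟩

lemma exists_bijection_succ {g h n : ℕ} (hg : 1 ≤ g) (hhn : h ≤ n + 1) :
    ∃ φ : Equiv.Perm (Fin n) × Fin (n + 1) → Equiv.Perm (Fin (n + 1)),
      Function.Bijective φ ∧
      ∀ (σ : Equiv.Perm (Fin n)) (c : Fin (n + 1)),
        gden g h (φ (σ, c)) = gden g h σ + (c : ℕ) ∧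
        ∀ l : ℕ, 1 ≤ l → h ≤ g + l →
          (((c : ℕ) ≤ gexc g l σ + g + l - 2 → gexc g l (φ (σ, c)) = gexc g l σ) ∧
           (gexc g l σ + g + l - 2 < (c : ℕ) → gexc g l (φ (σ, c)) = gexc g l σ + 1)) := by
  rcases lt_or_ge g (n + 1) with hgn | hgn
  · obtain ⟨N, hN⟩ := Nat.exists_eq_add_of_le (show g + (h - 1 - g) ≤ n by lia)
    obtain ⟨φ, hφ, hφ'⟩ := exists_bijection_posSet hN
    refine ⟨φ, hφ, fun σ c => ?_⟩
    obtain ⟨h1, h2⟩ := hφ' (σ, c)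
    refine ⟨by rw [gden_eq, h2, ← gden_eq], fun l hl hgl => ?_⟩
    have h3 := card_insertPos (g + (h - 1 - g)) N
      (relPos_subset (h - 1 - g) N (posSet g (h - 1 - g) σ)) (c := c) (by lia)
      (l - 1 - (h - 1 - g))
    rw [← h1, ← gexc_eq (n := n + 1) (by lia) _ hl hgl, ← gexc_eq (n := n) hN σ hl hgl] at h3
    rw [h3]
    split_ifs <;> lia
  · obtain ⟨φ, hφ, hφ'⟩ := exists_bijection_gden_of_le hgn h
    refine ⟨φ, hφ, fun σ c => ⟨hφ' (σ, c), fun l hl _ => ?_⟩⟩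
    rw [gexc_eq_zero hgn, gexc_eq_zero (by lia)]
    lia

end Bijection

/-- For `g ≥ 1` and `1 ≤ h ≤ n`, there is a bijection `φ : S_{n-1} × {0,…,n-1} → S_n`
with `g den_h(φ(σ,c)) = g den_h(σ) + c` and, for every `ℓ ≥ 1` with `g + ℓ ≥ h`,
`g exc_ℓ(φ(σ,c)) = g exc_ℓ(σ)` if `c ≤ g exc_ℓ(σ) + g + ℓ − 2` and
`g exc_ℓ(φ(σ,c)) = g exc_ℓ(σ) + 1` otherwise. -/
theorem exists_bijection_gexc_gden (g h n : ℕ) (hg : 1 ≤ g) (hh : 1 ≤ h) (hhn : h ≤ n) :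
    ∃ φ : Equiv.Perm (Fin (n - 1)) × Fin n → Equiv.Perm (Fin n),
      Function.Bijective φ ∧
      ∀ (σ : Equiv.Perm (Fin (n - 1))) (c : Fin n),
        gden g h (φ (σ, c)) = gden g h σ + (c : ℕ) ∧
        ∀ l : ℕ, 1 ≤ l → h ≤ g + l →
          (((c : ℕ) ≤ gexc g l σ + g + l - 2 → gexc g l (φ (σ, c)) = gexc g l σ) ∧
           (gexc g l σ + g + l - 2 < (c : ℕ) → gexc g l (φ (σ, c)) = gexc g l σ + 1)) := by
  obtain ⟨n, rfl⟩ := Nat.exists_eq_add_of_le' (hh.trans hhn)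
  exact exists_bijection_succ hg hhn

end PaperStmt
end

section
/- For every n ≥ 1, the pair (exc, den) is equidistributed with (des, maj) over S_n; that is, for all integers a, b, the number of σ ∈ S_n with exc(σ) = a and den(σ) = b equals the number of σ ∈ S_n with des(σ) = a and maj(σ) = b. (Denert's conjecture: (exc, den) is Euler–Mahonian.) -/
open Finset

namespace PaperStmt

/-- The increment of the second statistic when a letter is inserted at place `x`: `S` is the set of
active places and `n` the last place. -/
def increment (S : Finset ℕ) (n x : ℕ) : ℕ :=
  (S.filter fun e => x ≤ e).card + if x ∈ S ∨ x = n then 0 else x + 1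

lemma card_filter_lt_add_card_filter_le (S : Finset ℕ) (x : ℕ) :
    (S.filter fun e => e < x).card + (S.filter fun e => x ≤ e).card = S.card := by
  rw [← card_filter_add_card_filter_not (s := S) (fun e => e < x)]
  simp only [not_lt]

lemma increment_le_card_iff (S : Finset ℕ) (n x : ℕ) :
    increment S n x ≤ S.card ↔ x ∈ S ∨ x = n := by
  have h := card_filter_lt_add_card_filter_le S x
  have h1 : (S.filter fun e => e < x).card ≤ x := by
    calc _ ≤ (range x).card := card_le_card fun e he => by simp at he ⊢; exact he.2
      _ = x := card_range x
  unfold increment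
  split_ifs with hc
  · simp only [hc, iff_true]; omega
  · simp only [hc, iff_false]; omega

lemma increment_lt {S : Finset ℕ} {n x : ℕ} (hS : S ⊆ range n) (hx : x ≤ n) :
    increment S n x < n + 1 := by
  unfold increment
  split_ifs with hc
  · have := card_le_card ((filter_subset (fun e => x ≤ e) S).trans hS)
    rw [card_range] at this
    omega
  · have : (S.filter fun e => x ≤ e).card ≤ (Ioo x n).card := card_le_card fun e he => by
      simp only [mem_filter] at he
      have := hS he.1
      have hne : e ≠ x := fun h => hc (Or.inl (h ▸ he.1))
      simp at this ⊢
      omega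
    rw [Nat.card_Ioo] at this
    omega

lemma increment_injOn {S : Finset ℕ} {n : ℕ} :
    Set.InjOn (increment S n) (range (n + 1)) := by
  have key : ∀ x y, x < y → y ≤ n → increment S n x ≠ increment S n y := by
    intro x y hxy hy h
    have hiff := (increment_le_card_iff S n x).symm.trans
      (h ▸ increment_le_card_iff S n y)
    have hsplit : (S.filter fun e => x ≤ e).card
        = (S.filter fun e => y ≤ e).card + (S.filter fun e => x ≤ e ∧ e < y).card := by
      rw [← card_union_of_disjoint]
      · congr 1; ext e; simp only [mem_filter, mem_union]; grind
      · rw [disjoint_left]; intro e; simp only [mem_filter]; omega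
    unfold increment at h
    by_cases hc : x ∈ S ∨ x = n
    · rw [if_pos hc, if_pos (hiff.1 hc)] at h
      have hxS : x ∈ S := by rcases hc with h | h <;> [exact h; omega]
      have : 0 < (S.filter fun e => x ≤ e ∧ e < y).card :=
        card_pos.2 ⟨x, by simp [hxS, hxy]⟩
      omega
    · rw [if_neg hc, if_neg (fun h => hc (hiff.2 h))] at h
      have : (S.filter fun e => x ≤ e ∧ e < y).card ≤ (Ioo x y).card :=
        card_le_card fun e he => by
          simp only [mem_filter] at he
          have hne : e ≠ x := fun h => hc (Or.inl (h ▸ he.1))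
          simp only [mem_Ioo]
          omega
      rw [Nat.card_Ioo] at this
      omega
  intro x hx y hy h
  simp only [coe_range, Set.mem_Iio] at hx hy
  rcases lt_trichotomy x y with hlt | heq | hlt
  · exact absurd h (key x y hlt (by omega))
  · exact heq
  · exact absurd h.symm (key y x hlt (by omega))

/-- Summing over all insertion places depends on the set of active places only through its
cardinality. -/
lemma sum_increment {S : Finset ℕ} {n : ℕ} (hS : S ⊆ range n) (G : ℕ → ℕ → ℕ) (b : ℕ) :
    ∑ x : Fin (n + 1), G (S.card + if (x : ℕ) ∈ S ∨ (x : ℕ) = n then 0 else 1)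
        (b + increment S n x)
      = ∑ j ∈ range (n + 1), G (S.card + if j ≤ S.card then 0 else 1) (b + j) := by
  rw [Fin.sum_univ_eq_sum_range
    (fun x => G (S.card + if x ∈ S ∨ x = n then 0 else 1) (b + increment S n x)) (n + 1)]
  have hmaps : ∀ x ∈ range (n + 1), increment S n x ∈ range (n + 1) := fun x hx => by
    rw [mem_range] at hx ⊢
    exact increment_lt hS (by omega)
  refine sum_nbij (increment S n) hmaps increment_injOn
    (surjOn_of_injOn_of_card_le _ hmaps increment_injOn le_rfl) fun x _ => ?_
  simp only [increment_le_card_iff]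

/-- A pair of statistics behaving under an insertion procedure as described by `increment` has
the Euler–Mahonian recurrence. -/
lemma sum_perm_succ_of_insertion {n : ℕ} (ins : Equiv.Perm (Fin n) × Fin (n + 1) →
    Equiv.Perm (Fin (n + 1))) (hins : Function.Injective ins)
    (S : Equiv.Perm (Fin n) → Finset ℕ) (hS : ∀ σ, S σ ⊆ range n)
    (s t : Equiv.Perm (Fin n) → ℕ) (s' t' : Equiv.Perm (Fin (n + 1)) → ℕ)
    (hs : ∀ σ, s σ = (S σ).card)
    (hs' : ∀ σ x, s' (ins (σ, x)) = s σ + if (x : ℕ) ∈ S σ ∨ (x : ℕ) = n then 0 else 1)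
    (ht' : ∀ σ x, t' (ins (σ, x)) = t σ + increment (S σ) n x) (G : ℕ → ℕ → ℕ) :
    ∑ τ, G (s' τ) (t' τ) = ∑ σ, ∑ j ∈ range (n + 1),
      G (s σ + if j ≤ s σ then 0 else 1) (t σ + j) := by
  have hbij : Function.Bijective ins := by
    rw [Fintype.bijective_iff_injective_and_card]
    refine ⟨hins, ?_⟩
    simp [Fintype.card_perm, Nat.factorial_succ, mul_comm]
  rw [← hbij.sum_comp, Fintype.sum_prod_type]
  refine sum_congr rfl fun σ _ => ?_
  simp only [hs', ht', hs]
  exact sum_increment (hS σ) G (t σ)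

lemma val_succAbove {n : ℕ} (x : Fin (n + 1)) (i : Fin n) :
    (x.succAbove i : ℕ) = if (i : ℕ) < x then (i : ℕ) else i + 1 := by
  simp only [Fin.succAbove, Fin.lt_def, Fin.val_castSucc]
  split_ifs <;> simp

/-! ### Descents and the major index -/

/-- The set of descents of `σ`. -/
def descents {n : ℕ} (σ : Equiv.Perm (Fin n)) : Finset ℕ :=
  (univ.filter fun p : Fin n × Fin n =>
    pos1 p.2 = pos1 p.1 + 1 ∧ val1 σ p.2 < val1 σ p.1).image fun p => pos1 p.1

lemma pos1_injOn_descentPairs {n : ℕ} (σ : Equiv.Perm (Fin n)) :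
    Set.InjOn (fun p : Fin n × Fin n => pos1 p.1)
      (univ.filter fun p : Fin n × Fin n =>
        pos1 p.2 = pos1 p.1 + 1 ∧ val1 σ p.2 < val1 σ p.1) := by
  rintro ⟨i, j⟩ h ⟨i', j'⟩ h' heq
  simp only [mem_coe, mem_filter, mem_univ, true_and] at h h'
  simp only [pos1] at h h' heq
  ext <;> simp <;> omega

lemma des_eq_card {n : ℕ} (σ : Equiv.Perm (Fin n)) : des σ = (descents σ).card :=
  (card_image_of_injOn (pos1_injOn_descentPairs σ)).symm

lemma maj_eq_sum {n : ℕ} (σ : Equiv.Perm (Fin n)) : maj σ = ∑ d ∈ descents σ, d :=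
  (sum_image (f := fun d => d) (pos1_injOn_descentPairs σ)).symm

lemma mem_descents {n : ℕ} {σ : Equiv.Perm (Fin n)} {d : ℕ} :
    d ∈ descents σ ↔ ∃ i j : Fin n, (i : ℕ) + 1 = d ∧ (j : ℕ) = d ∧ σ j < σ i := by
  simp only [descents, mem_image, mem_filter, mem_univ, true_and, Prod.exists]
  simp only [pos1, val1, Fin.lt_def]
  constructor
  · rintro ⟨i, j, ⟨h1, h2⟩, h3⟩
    exact ⟨i, j, h3, by omega, by omega⟩
  · rintro ⟨i, j, h1, h2, h3⟩
    exact ⟨i, j, ⟨by omega, by omega⟩, h1⟩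

lemma descents_subset {n : ℕ} (σ : Equiv.Perm (Fin n)) : descents σ ⊆ range n := by
  intro d hd
  obtain ⟨i, j, -, rfl, -⟩ := mem_descents.1 hd
  simp

/-- Insert the largest letter at position `x`. -/
def insertMax {n : ℕ} (σ : Equiv.Perm (Fin n)) (x : Fin (n + 1)) : Equiv.Perm (Fin (n + 1)) :=
  (finSuccEquiv' x).trans (σ.optionCongr.trans (finSuccEquiv' (Fin.last n)).symm)

@[simp] lemma insertMax_self {n : ℕ} (σ : Equiv.Perm (Fin n)) (x : Fin (n + 1)) :
    insertMax σ x x = Fin.last n := by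
  simp [insertMax]

@[simp] lemma insertMax_succAbove {n : ℕ} (σ : Equiv.Perm (Fin n)) (x : Fin (n + 1))
    (i : Fin n) : insertMax σ x (x.succAbove i) = (σ i).castSucc := by
  simp [insertMax]

lemma insertMax_injective {n : ℕ} :
    Function.Injective fun p : Equiv.Perm (Fin n) × Fin (n + 1) => insertMax p.1 p.2 := by
  rintro ⟨σ, x⟩ ⟨ρ, y⟩ h
  simp only at h
  have hxy : x = y := by
    apply (insertMax σ x).injective
    conv_rhs => rw [h]
    simp
  subst hxy
  have : σ = ρ := by
    ext i
    have := congrArg (fun τ : Equiv.Perm (Fin (n + 1)) => (τ (x.succAbove i) : ℕ)) h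
    simpa using this
  rw [this]

lemma descents_insertMax {n : ℕ} (σ : Equiv.Perm (Fin n)) (x : Fin (n + 1)) :
    descents (insertMax σ x) =
      ((descents σ).filter fun d => d < (x : ℕ)) ∪
        (((descents σ).filter fun d => (x : ℕ) < d).map (addRightEmbedding 1) ∪
          if (x : ℕ) = n then ∅ else {(x : ℕ) + 1}) := by
  ext d
  simp only [mem_union, mem_filter, mem_map, addRightEmbedding_apply, mem_descents]
  constructor
  · rintro ⟨i, j, hi, hj, h⟩
    rcases Fin.eq_self_or_eq_succAbove x i with hxi | ⟨i', rfl⟩ <;>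
      rcases Fin.eq_self_or_eq_succAbove x j with hxj | ⟨j', rfl⟩
    · rw [hxi] at hi
      rw [hxj] at hj
      omega
    · rw [hxi] at hi
      rw [val_succAbove] at hj
      right; right
      rw [if_neg (by split_ifs at hj <;> omega)]
      simpa using hi.symm
    · rw [hxj] at h
      exact absurd h (by simp [Fin.le_last])
    · simp only [insertMax_succAbove, Fin.castSucc_lt_castSucc_iff] at h
      rw [val_succAbove] at hi hj
      by_cases hd : d < x
      · left
        refine ⟨⟨i', j', ?_, ?_, h⟩, hd⟩ <;> split_ifs at hi hj <;> omega
      · right; left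
        refine ⟨d - 1, ⟨⟨i', j', ?_, ?_, h⟩, ?_⟩, ?_⟩ <;> split_ifs at hi hj <;> omega
  · rintro (⟨⟨i, j, hi, hj, h⟩, hd⟩ | ⟨e, ⟨⟨i, j, hi, hj, h⟩, hd⟩, he⟩ | h)
    · refine ⟨x.succAbove i, x.succAbove j, ?_, ?_, by simpa using h⟩ <;>
        rw [val_succAbove] <;> split_ifs <;> omega
    · refine ⟨x.succAbove i, x.succAbove j, ?_, ?_, by simpa using h⟩ <;>
        rw [val_succAbove] <;> split_ifs <;> omega
    · split_ifs at h with hx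
      · simp at h
      · rw [mem_singleton] at h
        have hxn : (x : ℕ) < n := by omega
        refine ⟨x, x.succAbove ⟨x, hxn⟩, h.symm, ?_, ?_⟩
        · rw [val_succAbove]; simp [h]
        · simp [Fin.castSucc_lt_last]

lemma sum_descents_insertMax {n : ℕ} (σ : Equiv.Perm (Fin n)) (x : Fin (n + 1)) (g : ℕ → ℕ) :
    ∑ d ∈ descents (insertMax σ x), g d =
      ∑ d ∈ (descents σ).filter (fun d => d < (x : ℕ)), g d +
        (∑ d ∈ (descents σ).filter (fun d => (x : ℕ) < d), g (d + 1) +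
          if (x : ℕ) = n then 0 else g (x + 1)) := by
  rw [descents_insertMax, sum_union, sum_union, sum_map]
  · split_ifs <;> simp
  · split_ifs
    · simp
    · rw [disjoint_singleton_right]; simp
  · rw [disjoint_left]
    intro d hd hd'
    simp only [mem_union, mem_filter, mem_map, addRightEmbedding_apply] at hd hd'
    rcases hd' with ⟨e, he, h⟩ | h
    · omega
    · split_ifs at h
      · simp at h
      · rw [mem_singleton] at h; omega

lemma sum_filter_lt_add_filter_gt (S : Finset ℕ) (x : ℕ) (g : ℕ → ℕ) :
    ∑ d ∈ S, g d = ∑ d ∈ S.filter (fun d => d < x), g d +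
      (∑ d ∈ S.filter (fun d => x < d), g d + if x ∈ S then g x else 0) := by
  rw [← Finset.sum_ite_eq' S x g, sum_filter, sum_filter, ← sum_add_distrib, ← sum_add_distrib]
  refine sum_congr rfl fun d _ => ?_
  rcases lt_trichotomy d x with h | h | h
  · simp [h, h.ne, h.not_gt]
  · simp [h]
  · simp [h, h.ne', h.not_gt]

lemma des_insertMax {n : ℕ} (σ : Equiv.Perm (Fin n)) (x : Fin (n + 1)) :
    des (insertMax σ x) =
      des σ + if (x : ℕ) ∈ descents σ ∨ (x : ℕ) = n then 0 else 1 := by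
  rw [des_eq_card, des_eq_card, card_eq_sum_ones, card_eq_sum_ones, sum_descents_insertMax,
    sum_filter_lt_add_filter_gt (descents σ) x]
  have : (x : ℕ) ∈ descents σ → (x : ℕ) ≠ n := fun h => by
    have := descents_subset σ h
    simp at this; omega
  grind

lemma maj_insertMax {n : ℕ} (σ : Equiv.Perm (Fin n)) (x : Fin (n + 1)) :
    maj (insertMax σ x) = maj σ + increment (descents σ) n x := by
  have hmem : (x : ℕ) ∈ descents σ → (x : ℕ) ≠ n := fun h => by
    have := descents_subset σ h
    simp at this; omega
  have hcard : ((descents σ).filter fun e => (x : ℕ) ≤ e).card =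
      ((descents σ).filter fun e => (x : ℕ) < e).card +
        if (x : ℕ) ∈ descents σ then 1 else 0 := by
    have := sum_filter_lt_add_filter_gt (descents σ) x (fun _ => 1)
    simp only [← card_eq_sum_ones] at this
    have h2 := card_filter_lt_add_card_filter_le (descents σ) x
    omega
  rw [maj_eq_sum, maj_eq_sum, sum_descents_insertMax, sum_filter_lt_add_filter_gt (descents σ) x,
    sum_add_distrib, ← card_eq_sum_ones, increment, hcard]
  grind

/-! ### Excedances and Denert's statistic -/

/-- The set of excedance letters of `σ`, counted from `0`. -/
def excLetters {n : ℕ} (σ : Equiv.Perm (Fin n)) : Finset ℕ :=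
  (univ.filter fun i : Fin n => (i : ℕ) < σ i).image fun i => (σ i : ℕ)

lemma mem_excLetters {n : ℕ} {σ : Equiv.Perm (Fin n)} {e : ℕ} :
    e ∈ excLetters σ ↔ ∃ i : Fin n, (i : ℕ) < σ i ∧ (σ i : ℕ) = e := by
  simp [excLetters]

lemma mem_excLetters_apply {n : ℕ} {σ : Equiv.Perm (Fin n)} {i : Fin n} :
    (σ i : ℕ) ∈ excLetters σ ↔ (i : ℕ) < σ i := by
  rw [mem_excLetters]
  constructor
  · rintro ⟨j, h, hj⟩
    rwa [σ.injective (Fin.ext hj)] at h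
  · exact fun h => ⟨i, h, rfl⟩

lemma excLetters_subset {n : ℕ} (σ : Equiv.Perm (Fin n)) : excLetters σ ⊆ range n := by
  intro e he
  obtain ⟨i, -, rfl⟩ := mem_excLetters.1 he
  simp

lemma card_filter_excLetters {n : ℕ} (σ : Equiv.Perm (Fin n)) (P : ℕ → Prop) [DecidablePred P] :
    ((excLetters σ).filter P).card =
      (univ.filter fun i : Fin n => (i : ℕ) < σ i ∧ P (σ i)).card := by
  rw [excLetters, filter_image, card_image_of_injective, filter_filter]
  exact Fin.val_injective.comp σ.injective

lemma exc_eq_card {n : ℕ} (σ : Equiv.Perm (Fin n)) : exc σ = (excLetters σ).card := by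
  have := card_filter_excLetters σ (fun _ => True)
  simp only [filter_true, and_true] at this
  rw [this]
  simp [exc, excSet, pos1, val1]

lemma exists_excLetter_ge {n : ℕ} (σ : Equiv.Perm (Fin n)) (m : ℕ) :
    ∃ e, m ≤ e ∧ (e ∈ excLetters σ ∨ n ≤ e) :=
  ⟨max m n, le_max_left _ _, Or.inr (le_max_right _ _)⟩

/-- The least excedance letter `≥ m`, where all numbers from `n` on count as excedance
letters. -/
def nextExc {n : ℕ} (σ : Equiv.Perm (Fin n)) (m : ℕ) : ℕ := Nat.find (exists_excLetter_ge σ m)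

lemma le_nextExc {n : ℕ} (σ : Equiv.Perm (Fin n)) (m : ℕ) : m ≤ nextExc σ m :=
  (Nat.find_spec (exists_excLetter_ge σ m)).1

lemma nextExc_mem {n : ℕ} (σ : Equiv.Perm (Fin n)) (m : ℕ) :
    nextExc σ m ∈ excLetters σ ∨ n ≤ nextExc σ m :=
  (Nat.find_spec (exists_excLetter_ge σ m)).2

lemma nextExc_le {n : ℕ} {σ : Equiv.Perm (Fin n)} {m e : ℕ} (h : m ≤ e)
    (he : e ∈ excLetters σ ∨ n ≤ e) : nextExc σ m ≤ e :=
  Nat.find_min' _ ⟨h, he⟩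

lemma nextExc_le_apply {n : ℕ} {σ : Equiv.Perm (Fin n)} {m : ℕ} {i : Fin n} (h : m ≤ σ i)
    (hi : (i : ℕ) < σ i) : nextExc σ m ≤ σ i :=
  nextExc_le h (Or.inl (mem_excLetters_apply.2 hi))

lemma lt_of_nextExc_eq_apply {n : ℕ} {σ : Equiv.Perm (Fin n)} {m : ℕ} {i : Fin n}
    (h : nextExc σ m = σ i) : (i : ℕ) < σ i := by
  rcases nextExc_mem σ m with hm | hm
  · rwa [h, mem_excLetters_apply] at hm
  · have := (σ i).isLt
    omega

/-- The word obtained by Han's insertion at position `x`. -/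
def hanWord {n : ℕ} (σ : Equiv.Perm (Fin n)) (x : Fin (n + 1)) : Fin (n + 1) → ℕ :=
  x.insertNth (α := fun _ => ℕ) (nextExc σ x)
    fun i => if (i : ℕ) < σ i ∧ (x : ℕ) ≤ σ i then nextExc σ (σ i + 1) else σ i

@[simp] lemma hanWord_self {n : ℕ} (σ : Equiv.Perm (Fin n)) (x : Fin (n + 1)) :
    hanWord σ x x = nextExc σ x := by
  simp [hanWord]

@[simp] lemma hanWord_succAbove {n : ℕ} (σ : Equiv.Perm (Fin n)) (x : Fin (n + 1)) (i : Fin n) :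
    hanWord σ x (x.succAbove i) =
      if (i : ℕ) < σ i ∧ (x : ℕ) ≤ σ i then nextExc σ (σ i + 1) else σ i := by
  simp [hanWord]

lemma hanWord_lt {n : ℕ} (σ : Equiv.Perm (Fin n)) (x p : Fin (n + 1)) :
    hanWord σ x p < n + 1 := by
  rcases Fin.eq_self_or_eq_succAbove x p with rfl | ⟨i, rfl⟩
  · have := nextExc_le (σ := σ) (m := p) (e := n) (by omega) (Or.inr le_rfl)
    simp; omega
  · have := nextExc_le (σ := σ) (m := σ i + 1) (e := n) (by omega) (Or.inr le_rfl)
    simp; split_ifs <;> omega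

lemma hanWord_injective {n : ℕ} (σ : Equiv.Perm (Fin n)) (x : Fin (n + 1)) :
    Function.Injective (hanWord σ x) := by
  have hself : ∀ i, hanWord σ x x ≠ hanWord σ x (x.succAbove i) := by
    intro i h
    rw [hanWord_self, hanWord_succAbove] at h
    split_ifs at h with hc
    · have := nextExc_le_apply hc.2 hc.1
      have := le_nextExc σ (σ i + 1)
      omega
    · have := lt_of_nextExc_eq_apply h
      have := le_nextExc σ x
      omega
  have hmixed : ∀ i j : Fin n, (i : ℕ) < σ i ∧ (x : ℕ) ≤ σ i →
      ¬ ((j : ℕ) < σ j ∧ (x : ℕ) ≤ σ j) → nextExc σ (σ i + 1) ≠ σ j := by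
    intro i j hi hj h
    have := lt_of_nextExc_eq_apply h
    have := le_nextExc σ (σ i + 1)
    omega
  intro p q h
  rcases Fin.eq_self_or_eq_succAbove x p with hp | ⟨i, rfl⟩ <;>
    rcases Fin.eq_self_or_eq_succAbove x q with hq | ⟨j, rfl⟩
  · rw [hp, hq]
  · rw [hp] at h
    exact absurd h (hself j)
  · rw [hq] at h
    exact absurd h.symm (hself i)
  · congr 1
    apply σ.injective
    ext
    rw [hanWord_succAbove, hanWord_succAbove] at h
    split_ifs at h with hi hj hj
    · have h1 := le_nextExc σ (σ i + 1)
      have h2 := le_nextExc σ (σ j + 1)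
      rcases lt_trichotomy (σ i : ℕ) (σ j) with hlt | heq | hlt
      · have := nextExc_le_apply (m := σ i + 1) hlt hj.1
        omega
      · exact heq
      · have := nextExc_le_apply (m := σ j + 1) hlt hi.1
        omega
    · exact absurd h (hmixed i j hi hj)
    · exact absurd h.symm (hmixed j i hj hi)
    · exact h

/-- Han's insertion of a new position `x` into `σ`: the excedance letters `≥ x`, followed by the
new letter `n`, are shifted cyclically, the least of them being put at position `x`. -/
noncomputable def hanInsert {n : ℕ} (σ : Equiv.Perm (Fin n)) (x : Fin (n + 1)) :
    Equiv.Perm (Fin (n + 1)) :=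
  Equiv.ofBijective (fun p => ⟨hanWord σ x p, hanWord_lt σ x p⟩) <|
    Finite.injective_iff_bijective.1 fun p q h =>
      hanWord_injective σ x (by simpa using h)

@[simp] lemma val_hanInsert {n : ℕ} (σ : Equiv.Perm (Fin n)) (x p : Fin (n + 1)) :
    (hanInsert σ x p : ℕ) = hanWord σ x p := rfl

lemma lt_hanWord_succAbove_iff {n : ℕ} (σ : Equiv.Perm (Fin n)) (x : Fin (n + 1)) (i : Fin n) :
    (x.succAbove i : ℕ) < hanWord σ x (x.succAbove i) ↔ (i : ℕ) < σ i := by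
  have := le_nextExc σ (σ i + 1)
  rw [hanWord_succAbove, val_succAbove]
  split_ifs <;> omega

/-- The letters changed by Han's insertion can be read off from its result. -/
lemma shifted_iff {n : ℕ} (σ : Equiv.Perm (Fin n)) (x : Fin (n + 1)) (i : Fin n) :
    ((i : ℕ) < σ i ∧ (x : ℕ) ≤ σ i) ↔ (x.succAbove i : ℕ) < hanWord σ x (x.succAbove i) ∧
      hanWord σ x x < hanWord σ x (x.succAbove i) := by
  rw [lt_hanWord_succAbove_iff, hanWord_self, hanWord_succAbove]
  refine and_congr_right fun hi => ?_
  constructor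
  · intro hx
    have := nextExc_le_apply hx hi
    have := le_nextExc σ (σ i + 1)
    rw [if_pos ⟨hi, hx⟩]
    omega
  · intro h
    by_contra hx
    have := le_nextExc σ x
    rw [if_neg (fun h => hx h.2)] at h
    omega

lemma eq_of_hanWord_eq {n : ℕ} {σ ρ : Equiv.Perm (Fin n)} {x : Fin (n + 1)}
    (h : hanWord σ x = hanWord ρ x) : σ = ρ := by
  have hshift : ∀ i : Fin n, ((i : ℕ) < σ i ∧ (x : ℕ) ≤ σ i) ↔ ((i : ℕ) < ρ i ∧ (x : ℕ) ≤ ρ i) :=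
    fun i => by rw [shifted_iff, shifted_iff, h]
  have key : ∀ {σ ρ : Equiv.Perm (Fin n)}, hanWord σ x = hanWord ρ x →
      (∀ i : Fin n, ((i : ℕ) < σ i ∧ (x : ℕ) ≤ σ i) ↔ ((i : ℕ) < ρ i ∧ (x : ℕ) ≤ ρ i)) →
      ∀ i, ¬ (σ i : ℕ) < ρ i := by
    intro σ ρ h hshift i hlt
    have happ : ∀ j, _ := fun j => congrFun h (x.succAbove j)
    simp only [hanWord_succAbove] at happ
    by_cases hi : (i : ℕ) < σ i ∧ (x : ℕ) ≤ σ i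
    · have hi' := (hshift i).1 hi
      have h1 := happ i
      rw [if_pos hi, if_pos hi'] at h1
      obtain ⟨j, hj⟩ := σ.surjective (ρ i)
      by_cases hjs : (j : ℕ) < σ j ∧ (x : ℕ) ≤ σ j
      · have := nextExc_le_apply (m := σ i + 1) (i := j) (by rw [hj]; exact hlt) hjs.1
        have := le_nextExc ρ (ρ i + 1)
        rw [hj] at *
        omega
      · have h2 := happ j
        rw [if_neg hjs, if_neg (fun h => hjs ((hshift j).2 h)), hj] at h2
        have : i = j := ρ.injective (Fin.ext h2)
        exact hjs (this ▸ hi)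
    · have h1 := happ i
      rw [if_neg hi, if_neg (fun h => hi ((hshift i).2 h))] at h1
      omega
  ext i
  have h1 := key h hshift i
  have h2 := key h.symm (fun i => (hshift i).symm) i
  omega

lemma not_lt_of_hanWord_eq {n : ℕ} {σ ρ : Equiv.Perm (Fin n)} {x y : Fin (n + 1)}
    (h : hanWord σ x = hanWord ρ y) : ¬ hanWord σ x x < hanWord ρ y y := by
  intro hlt
  have hx := le_nextExc σ x
  have hy := le_nextExc ρ y
  have hyx : y ≠ x := by
    rintro rfl
    rw [h] at hlt
    exact lt_irrefl _ hlt
  obtain ⟨i, hi⟩ := Fin.exists_succAbove_eq hyx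
  have hyi : (y : ℕ) = if (i : ℕ) < x then (i : ℕ) else i + 1 := by rw [← hi, val_succAbove]
  have hτy : hanWord σ x (x.succAbove i) = nextExc ρ y := by rw [hi, h, hanWord_self]
  rw [hanWord_self, hanWord_self] at hlt
  rw [hanWord_succAbove] at hτy
  have hs : (i : ℕ) < σ i ∧ (x : ℕ) ≤ σ i := by
    by_contra hns
    rw [if_neg hns] at hτy
    split_ifs at hyi <;> omega
  rw [if_pos hs] at hτy
  have hu := nextExc_le_apply hs.2 hs.1
  have hui := le_nextExc σ (σ i + 1)
  have hu_not : ∀ k : Fin n, (k : ℕ) < ρ k → (ρ k : ℕ) ≠ σ i := by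
    intro k hk hki
    have := nextExc_le_apply (σ := ρ) (m := y) (i := k) (by rw [hki]; split_ifs at hyi <;> omega) hk
    omega
  -- the position of the letter `σ i` in the common word
  have hz : ∀ z : Fin (n + 1), hanWord σ x z = σ i → ∃ k : Fin n, y.succAbove k = z ∧
      (ρ k : ℕ) = σ i ∧ (ρ k : ℕ) ≤ k := by
    intro z hz
    have hzy : z ≠ y := by
      rintro rfl
      rw [h, hanWord_self] at hz
      omega
    obtain ⟨k, hk⟩ := Fin.exists_succAbove_eq hzy
    rw [← hk, h, hanWord_succAbove] at hz
    split_ifs at hz with hks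
    · have := nextExc_le_apply hks.2 hks.1
      have := le_nextExc ρ (ρ k + 1)
      omega
    · exact ⟨k, hk, hz, not_lt.1 fun hlt => hu_not k hlt hz⟩
  obtain ⟨z, hzσ⟩ := (hanInsert σ x).surjective (σ i).castSucc
  replace hzσ : hanWord σ x z = σ i := by
    have := congrArg Fin.val hzσ
    simpa using this
  obtain ⟨k, hk, hρk, hle⟩ := hz z hzσ
  have hzk : (z : ℕ) = if (k : ℕ) < y then (k : ℕ) else k + 1 := by rw [← hk, val_succAbove]
  rcases Fin.eq_self_or_eq_succAbove x z with rfl | ⟨l, rfl⟩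
  · split_ifs at hyi hzk <;> omega
  · rw [hanWord_succAbove] at hzσ
    split_ifs at hzσ with hl
    · have := le_nextExc σ (σ l + 1)
      have := (lt_hanWord_succAbove_iff σ x l).2 hl.1
      rw [hanWord_succAbove, if_pos hl] at this
      split_ifs at hzk <;> omega
    · have : l = i := σ.injective (Fin.ext hzσ)
      exact hl (this ▸ hs)

lemma hanInsert_injective {n : ℕ} :
    Function.Injective fun p : Equiv.Perm (Fin n) × Fin (n + 1) => hanInsert p.1 p.2 := by
  rintro ⟨σ, x⟩ ⟨ρ, y⟩ h
  have hword : hanWord σ x = hanWord ρ y := funext fun p =>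
    congrArg (fun τ : Equiv.Perm (Fin (n + 1)) => (τ p : ℕ)) h
  have hval : hanWord σ x x = hanWord ρ y y :=
    le_antisymm (not_lt.1 (not_lt_of_hanWord_eq hword.symm)) (not_lt.1 (not_lt_of_hanWord_eq hword))
  have hxy : x = y := hanWord_injective σ x (by rw [hval, hword])
  subst hxy
  rw [eq_of_hanWord_eq hword]

lemma self_lt_hanWord_iff {n : ℕ} (σ : Equiv.Perm (Fin n)) (x : Fin (n + 1)) :
    (x : ℕ) < hanWord σ x x ↔ ¬ ((x : ℕ) ∈ excLetters σ ∨ (x : ℕ) = n) := by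
  rw [hanWord_self]
  constructor
  · intro h hx
    have := nextExc_le (σ := σ) (m := x) le_rfl (hx.imp_right fun h => h.ge)
    omega
  · intro hx
    refine lt_of_le_of_ne (le_nextExc σ x) fun h => hx ?_
    have := nextExc_mem σ x
    rw [← h] at this
    exact this.imp_right fun h => by omega

lemma exc_hanInsert {n : ℕ} (σ : Equiv.Perm (Fin n)) (x : Fin (n + 1)) :
    exc (hanInsert σ x) =
      exc σ + if (x : ℕ) ∈ excLetters σ ∨ (x : ℕ) = n then 0 else 1 := by
  simp only [exc, excSet, card_filter, pos1, val1, add_lt_add_iff_right, val_hanInsert]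
  rw [Fin.sum_univ_succAbove _ x]
  simp only [lt_hanWord_succAbove_iff, self_lt_hanWord_iff, ite_not]
  rw [add_comm]

lemma hanWord_lt_hanWord_iff_of_exc {n : ℕ} (σ : Equiv.Perm (Fin n)) (x : Fin (n + 1))
    {i j : Fin n} (hi : (i : ℕ) < σ i) (hj : (j : ℕ) < σ j) :
    hanWord σ x (x.succAbove i) < hanWord σ x (x.succAbove j) ↔ (σ i : ℕ) < σ j := by
  have key : ∀ {i j : Fin n}, (i : ℕ) < σ i → (j : ℕ) < σ j → (σ i : ℕ) < σ j →
      hanWord σ x (x.succAbove i) < hanWord σ x (x.succAbove j) := by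
    intro i j hi hj h
    have h1 := le_nextExc σ (σ j + 1)
    have h2 := nextExc_le_apply (m := σ i + 1) h hj
    rw [hanWord_succAbove, hanWord_succAbove]
    split_ifs <;> omega
  refine ⟨fun h => ?_, key hi hj⟩
  rcases lt_trichotomy (σ i : ℕ) (σ j) with hlt | heq | hlt
  · exact hlt
  · rw [σ.injective (Fin.ext heq)] at h
    omega
  · have := key hj hi hlt
    omega

lemma invOn_eq_sum_succAbove {n : ℕ} (τ : Equiv.Perm (Fin (n + 1))) (P : Fin (n + 1) → Prop)
    [DecidablePred P] (x : Fin (n + 1)) :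
    invOn τ P =
      (∑ i : Fin n, if P x ∧ P (x.succAbove i) ∧ (((i : ℕ) < x ∧ τ x < τ (x.succAbove i)) ∨
        ((x : ℕ) ≤ i ∧ τ (x.succAbove i) < τ x)) then 1 else 0) +
      ∑ i : Fin n, ∑ j : Fin n, if i < j ∧ P (x.succAbove i) ∧ P (x.succAbove j) ∧
        τ (x.succAbove j) < τ (x.succAbove i) then 1 else 0 := by
  simp only [invOn, card_filter, Fintype.sum_prod_type, val1, add_lt_add_iff_right, Fin.val_fin_lt]
  rw [Fin.sum_univ_succAbove _ x, Fin.sum_univ_succAbove _ x]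
  simp only [Fin.sum_univ_succAbove _ x, lt_irrefl, false_and, if_false, zero_add,
    sum_add_distrib, Fin.succAbove_lt_succAbove_iff]
  rw [← add_assoc, ← sum_add_distrib]
  congr 1
  refine sum_congr rfl fun i _ => ?_
  have h1 : x < x.succAbove i ↔ (x : ℕ) ≤ i := by
    rw [Fin.lt_def, val_succAbove]; split_ifs <;> omega
  have h2 : x.succAbove i < x ↔ (i : ℕ) < x := by
    rw [Fin.lt_def, val_succAbove]; split_ifs <;> omega
  simp only [h1, h2]
  by_cases hx : (i : ℕ) < x
  · grind
  · grind

lemma card_exc_crossing {n : ℕ} (σ : Equiv.Perm (Fin n)) (x : ℕ) :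
    ∑ i : Fin n, (if (i : ℕ) < x ∧ x ≤ σ i then 1 else 0) =
      ∑ i : Fin n, if x ≤ (i : ℕ) ∧ (σ i : ℕ) < x then 1 else 0 := by
  have h := Equiv.sum_comp σ fun i : Fin n => if x ≤ (i : ℕ) then 1 else 0
  have h1 : ∑ i : Fin n, (if x ≤ (σ i : ℕ) then 1 else 0) =
      ∑ i : Fin n, (if (i : ℕ) < x ∧ x ≤ σ i then 1 else 0) +
        ∑ i : Fin n, if x ≤ (i : ℕ) ∧ x ≤ σ i then 1 else 0 := by
    rw [← sum_add_distrib]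
    exact sum_congr rfl fun i _ => by split_ifs <;> omega
  have h2 : ∑ i : Fin n, (if x ≤ (i : ℕ) then 1 else 0) =
      ∑ i : Fin n, (if x ≤ (i : ℕ) ∧ (σ i : ℕ) < x then 1 else 0) +
        ∑ i : Fin n, if x ≤ (i : ℕ) ∧ x ≤ σ i then 1 else 0 := by
    rw [← sum_add_distrib]
    exact sum_congr rfl fun i _ => by split_ifs <;> omega
  omega

lemma invOn_eq_sum {n : ℕ} (σ : Equiv.Perm (Fin n)) (P : Fin n → Prop) [DecidablePred P] :
    invOn σ P = ∑ i : Fin n, ∑ j : Fin n, if i < j ∧ P i ∧ P j ∧ σ j < σ i then 1 else 0 := by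
  simp only [invOn, card_filter, Fintype.sum_prod_type, val1, add_lt_add_iff_right, Fin.val_fin_lt]

lemma invOn_exc_hanInsert {n : ℕ} (σ : Equiv.Perm (Fin n)) (x : Fin (n + 1)) :
    invOn (hanInsert σ x) (fun p => pos1 p < val1 (hanInsert σ x) p) =
      (if (x : ℕ) ∈ excLetters σ ∨ (x : ℕ) = n then 0 else
        ∑ i : Fin n, if (i : ℕ) < x ∧ (x : ℕ) ≤ σ i then 1 else 0) +
      invOn σ (fun i => pos1 i < val1 σ i) := by
  rw [invOn_eq_sum_succAbove _ _ x, invOn_eq_sum]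
  simp only [pos1, val1, add_lt_add_iff_right, val_hanInsert, Fin.lt_def,
    lt_hanWord_succAbove_iff, self_lt_hanWord_iff]
  congr 1
  · split_ifs with hx
    · simp [hx]
    · refine sum_congr rfl fun i _ => ?_
      have h0 := le_nextExc σ x
      have h1 := le_nextExc σ (σ i + 1)
      have h2 := @nextExc_le_apply _ σ x i
      simp only [hx, not_false_eq_true, true_and, hanWord_self, hanWord_succAbove]
      grind
  · refine sum_congr rfl fun i _ => sum_congr rfl fun j _ => ?_
    refine if_congr (and_congr_right fun _ => ?_) rfl rfl
    exact and_congr_right fun hi => and_congr_right fun hj =>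
      hanWord_lt_hanWord_iff_of_exc σ x hj hi

lemma invOn_not_exc_hanInsert {n : ℕ} (σ : Equiv.Perm (Fin n)) (x : Fin (n + 1)) :
    invOn (hanInsert σ x) (fun p => ¬ pos1 p < val1 (hanInsert σ x) p) =
      (if (x : ℕ) ∈ excLetters σ ∨ (x : ℕ) = n then
        ∑ i : Fin n, if (i : ℕ) < x ∧ (x : ℕ) ≤ σ i then 1 else 0 else 0) +
      invOn σ (fun i => ¬ pos1 i < val1 σ i) := by
  rw [invOn_eq_sum_succAbove _ _ x, invOn_eq_sum, card_exc_crossing]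
  simp only [pos1, val1, add_lt_add_iff_right, val_hanInsert, Fin.lt_def,
    lt_hanWord_succAbove_iff]
  congr 1
  · have hx' := self_lt_hanWord_iff σ x
    split_ifs with hx
    · have h0 := le_nextExc σ x
      refine sum_congr rfl fun i _ => ?_
      simp only [hanWord_self] at hx'
      simp only [hanWord_self, hanWord_succAbove]
      have : nextExc σ x = x := by grind
      rw [this]
      grind
    · have hlt := hx'.2 hx
      simp only [hlt, not_true_eq_false, false_and, if_false, sum_const_zero]
  · refine sum_congr rfl fun i _ => sum_congr rfl fun j _ => ?_
    refine if_congr (and_congr_right fun _ => ?_) rfl rfl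
    refine and_congr_right fun hi => and_congr_right fun hj => ?_
    rw [hanWord_succAbove, hanWord_succAbove, if_neg (fun h => hj h.1), if_neg (fun h => hi h.1)]

lemma den_hanInsert {n : ℕ} (σ : Equiv.Perm (Fin n)) (x : Fin (n + 1)) :
    den (hanInsert σ x) = den σ + increment (excLetters σ) n x := by
  have hsum : (univ.filter fun p => pos1 p < val1 (hanInsert σ x) p).sum pos1 =
      (if (x : ℕ) ∈ excLetters σ ∨ (x : ℕ) = n then 0 else (x : ℕ) + 1) +
      ((univ.filter fun i => pos1 i < val1 σ i).sum pos1 +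
        ∑ i : Fin n, if (i : ℕ) < σ i ∧ (x : ℕ) ≤ i then 1 else 0) := by
    rw [sum_filter, sum_filter, Fin.sum_univ_succAbove _ x, ← sum_add_distrib]
    simp only [pos1, val1, add_lt_add_iff_right, val_hanInsert, lt_hanWord_succAbove_iff,
      self_lt_hanWord_iff, ite_not]
    congr 1
    refine sum_congr rfl fun i _ => ?_
    rw [val_succAbove]
    split_ifs <;> omega
  have hcard : ((excLetters σ).filter fun e => (x : ℕ) ≤ e).card =
      ∑ i : Fin n, (if (i : ℕ) < σ i ∧ (x : ℕ) ≤ i then 1 else 0) +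
      ∑ i : Fin n, if (i : ℕ) < x ∧ (x : ℕ) ≤ σ i then 1 else 0 := by
    rw [card_filter_excLetters σ fun e => (x : ℕ) ≤ e, card_filter, ← sum_add_distrib]
    exact sum_congr rfl fun i _ => by split_ifs <;> omega
  rw [den, den, hsum, invOn_exc_hanInsert, invOn_not_exc_hanInsert, increment, hcard]
  split_ifs <;> omega

lemma sum_exc_den_eq_sum_des_maj (n : ℕ) (G : ℕ → ℕ → ℕ) :
    ∑ σ : Equiv.Perm (Fin n), G (exc σ) (den σ) = ∑ σ : Equiv.Perm (Fin n), G (des σ) (maj σ) := by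
  induction n generalizing G with
  | zero =>
    refine sum_congr rfl fun σ _ => ?_
    simp [exc, excSet, den, invOn, des, maj]
  | succ n ih =>
    rw [sum_perm_succ_of_insertion (fun p => hanInsert p.1 p.2) hanInsert_injective excLetters
        excLetters_subset exc den exc den exc_eq_card exc_hanInsert den_hanInsert G,
      sum_perm_succ_of_insertion (fun p => insertMax p.1 p.2) insertMax_injective descents
        descents_subset des maj des maj des_eq_card des_insertMax maj_insertMax G]
    exact ih fun s t => ∑ j ∈ range (n + 1), G (s + if j ≤ s then 0 else 1) (t + j)

/-- Denert's conjecture: the pair `(exc, den)` is Euler–Mahonian, i.e. equidistributed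
with `(des, maj)` over `S_n`. -/
theorem exc_den_is_euler_mahonian (n : ℕ) (hn : 1 ≤ n) (a b : ℕ) :
    ((univ : Finset (Equiv.Perm (Fin n))).filter fun σ =>
        exc σ = a ∧ den σ = b).card
      = ((univ : Finset (Equiv.Perm (Fin n))).filter fun σ =>
          des σ = a ∧ maj σ = b).card := by
  simp only [card_filter]
  exact sum_exc_den_eq_sum_des_maj n fun s t => if s = a ∧ t = b then 1 else 0

end PaperStmt
end

section
/- For every integer r ≥ 1 and every n ≥ 1, the statistics rdes and rexc are equidistributed over S_n; that is, for every integer a, the number of σ ∈ S_n with rdes(σ) = a equals the number of σ ∈ S_n with rexc(σ) = a. -/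
open Finset

namespace PaperStmt

/-- If a statistic with value `s` changes by `[k ∈ A] - [k ∈ B]` under the insertion indexed by `k`,
where `B ⊆ A`, then it increases by one for `#A - #B` of the insertions and is unchanged for the
others. -/
theorem sum_comp_of_add_indicator_eq {n : ℕ} (f : ℕ → ℕ) (s : ℕ) (t : Fin n → ℕ)
    (A B : Finset (Fin n)) (hBA : B ⊆ A)
    (h : ∀ k, t k + (if k ∈ B then 1 else 0) = s + (if k ∈ A then 1 else 0)) :
    ∑ k, f (t k) = (A.card - B.card) * f (s + 1) + (n - (A.card - B.card)) * f s := by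
  have ht : ∀ k, f (t k) = if k ∈ A \ B then f (s + 1) else f s := by
    intro k
    have hk := h k
    have hk' := @hBA k
    by_cases hA : k ∈ A <;> by_cases hB : k ∈ B <;> simp_all
  have h1 : (univ.filter fun k => k ∈ A \ B) = A \ B := by ext; simp
  have h2 : (univ.filter fun k => k ∉ A \ B) = (A \ B)ᶜ := by ext; simp
  simp_rw [ht]
  rw [sum_ite, h1, h2, sum_const, sum_const, card_compl, Fintype.card_fin,
    card_sdiff_of_subset hBA, smul_eq_mul, smul_eq_mul]

theorem card_filter_le_val_succ {n r : ℕ} (hr : 1 ≤ r) :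
    (univ.filter fun k : Fin n => r ≤ (k : ℕ) + 1).card = n + 1 - r := by
  have h : (univ.filter fun k : Fin n => r ≤ (k : ℕ) + 1).map Fin.valEmbedding
      = Ico (r - 1) n := by
    ext x
    simp only [mem_map, mem_filter, mem_univ, true_and, Fin.valEmbedding_apply, mem_Ico]
    constructor
    · rintro ⟨k, hk, rfl⟩
      omega
    · intro hx
      exact ⟨⟨x, hx.2⟩, by simp only; omega, rfl⟩
  rw [← card_map Fin.valEmbedding, h, Nat.card_Ico]
  omega

/-- The sum of `f (stat σ')` over the `n + 1` permutations `σ'` obtained from a permutation of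
`Fin n` with `stat σ = s` by an insertion, where `stat` is `rdes` or `rexc`. -/
def insertionSum (r n : ℕ) (f : ℕ → ℕ) (s : ℕ) : ℕ :=
  f s + ((n + 1 - r - s) * f (s + 1) + (n - (n + 1 - r - s)) * f s)

theorem rexc_eq_sum {n : ℕ} (r : ℕ) (σ : Equiv.Perm (Fin n)) :
    rexc r σ = ∑ i : Fin n, if (i : ℕ) + r ≤ σ i then 1 else 0 := by
  rw [rexc, card_filter]
  refine sum_congr rfl fun i _ => if_congr ?_ rfl rfl
  simp only [pos1, val1]
  omega

theorem rexc_decomposeFin_symm_zero {n : ℕ} {r : ℕ} (hr : 1 ≤ r) (e : Equiv.Perm (Fin n)) :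
    rexc r (Equiv.Perm.decomposeFin.symm (0, e)) = rexc r e := by
  simp only [rexc_eq_sum, Fin.sum_univ_succ,
    Equiv.Perm.decomposeFin_symm_apply_zero, Equiv.Perm.decomposeFin_symm_apply_succ,
    Equiv.swap_self, Equiv.refl_apply, Fin.val_succ, Fin.val_zero]
  rw [if_neg (by omega), zero_add]
  exact sum_congr rfl fun i _ => if_congr (by omega) rfl rfl

theorem rexc_decomposeFin_symm_succ {n : ℕ} {r : ℕ} (hr : 1 ≤ r) (e : Equiv.Perm (Fin n))
    (k : Fin n) :
    rexc r (Equiv.Perm.decomposeFin.symm (k.succ, e)) + (if (e.symm k : ℕ) + r ≤ k then 1 else 0)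
      = rexc r e + (if r ≤ (k : ℕ) + 1 then 1 else 0) := by
  have hswap : ∀ i, (Equiv.swap 0 k.succ (e i).succ : Fin (n + 1)) =
      if e i = k then 0 else (e i).succ := by
    intro i
    by_cases h : e i = k
    · simp [h]
    · rw [if_neg h, Equiv.swap_apply_of_ne_of_ne (Fin.succ_ne_zero _) (by simpa using h)]
  have hsingle : (if (e.symm k : ℕ) + r ≤ k then 1 else 0)
      = ∑ i, if i = e.symm k then (if (e.symm k : ℕ) + r ≤ k then 1 else 0) else 0 := by
    rw [sum_ite_eq' univ (e.symm k)]
    simp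
  rw [hsingle]
  simp only [rexc_eq_sum, Fin.sum_univ_succ,
    Equiv.Perm.decomposeFin_symm_apply_zero, Equiv.Perm.decomposeFin_symm_apply_succ,
    hswap, Fin.val_succ, Fin.val_zero]
  rw [add_assoc, ← sum_add_distrib, add_comm]
  congr 1
  · refine sum_congr rfl fun i _ => ?_
    by_cases h : e i = k
    · have hi : i = e.symm k := by simp [← h]
      have hk : e (e.symm k) = k := by simp
      simp only [hi, hk, if_true, Fin.val_zero]
      rw [if_neg (by omega), zero_add]
    · have hi : i ≠ e.symm k := fun hi => h (by simp [hi])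
      simp only [h, hi, if_false, Fin.val_succ, add_zero]
      exact if_congr (by omega) rfl rfl
  · exact if_congr (by omega) rfl rfl

theorem sum_rexc_succ {r : ℕ} (hr : 1 ≤ r) (n : ℕ) (f : ℕ → ℕ) :
    ∑ σ : Equiv.Perm (Fin (n + 1)), f (rexc r σ)
      = ∑ e : Equiv.Perm (Fin n), insertionSum r n f (rexc r e) := by
  rw [← Equiv.sum_comp Equiv.Perm.decomposeFin.symm, Fintype.sum_prod_type_right]
  refine sum_congr rfl fun e _ => ?_
  rw [Fin.sum_univ_succ, rexc_decomposeFin_symm_zero hr, insertionSum]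
  congr 1
  have hB : (univ.filter fun k : Fin n => (e.symm k : ℕ) + r ≤ k).card = rexc r e := by
    rw [rexc_eq_sum, card_filter,
      ← Equiv.sum_comp e.symm fun i => if (i : ℕ) + r ≤ e i then 1 else 0]
    simp only [Equiv.apply_symm_apply]
  rw [sum_comp_of_add_indicator_eq f (rexc r e) _
    (univ.filter fun k : Fin n => r ≤ (k : ℕ) + 1)
    (univ.filter fun k : Fin n => (e.symm k : ℕ) + r ≤ k), card_filter_le_val_succ hr, hB]
  · intro k
    simp only [mem_filter, mem_univ, true_and]
    omega
  · intro k
    simpa only [mem_filter, mem_univ, true_and] using rexc_decomposeFin_symm_succ hr e k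

/-- Insert a new smallest letter at position `p` of the word of `e`. -/
def insertMin {n : ℕ} (p : Fin (n + 1)) (e : Equiv.Perm (Fin n)) : Equiv.Perm (Fin (n + 1)) :=
  Equiv.Perm.decomposeFin.symm (0, e) * p.cycleRange

@[simp]
theorem insertMin_apply_self {n : ℕ} (p : Fin (n + 1)) (e : Equiv.Perm (Fin n)) :
    insertMin p e p = 0 := by
  simp [insertMin]

@[simp]
theorem insertMin_apply_succAbove {n : ℕ} (p : Fin (n + 1)) (e : Equiv.Perm (Fin n))
    (j : Fin n) : insertMin p e (p.succAbove j) = (e j).succ := by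
  simp [insertMin]

theorem insertMin_bijective (n : ℕ) :
    Function.Bijective fun x : Fin (n + 1) × Equiv.Perm (Fin n) => insertMin x.1 x.2 := by
  rw [Fintype.bijective_iff_injective_and_card]
  constructor
  · rintro ⟨p, e⟩ ⟨q, d⟩ h
    simp only at h
    have hpq : p = q := (insertMin q d).injective (by
      rw [← h, insertMin_apply_self, h, insertMin_apply_self])
    subst hpq
    simp only [Prod.mk.injEq, true_and]
    ext j
    have := congrArg (fun σ => σ (p.succAbove j)) h
    simpa [Fin.ext_iff] using this
  · simp [Fintype.card_perm, Nat.factorial_succ]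

theorem rdes_eq_sum {n : ℕ} (r : ℕ) (σ : Equiv.Perm (Fin n)) :
    rdes r σ = ∑ x : Fin n, ∑ y : Fin n, if (y : ℕ) = x + 1 ∧ (σ y : ℕ) + r ≤ σ x then 1 else 0 := by
  rw [rdes, rdesPairs, card_filter, Fintype.sum_prod_type]
  refine sum_congr rfl fun x _ => sum_congr rfl fun y _ => if_congr ?_ rfl rfl
  simp only [pos1, val1]
  omega

/-- The `r`-descents of `insertMin p e` are those inherited from `e` and those ending in the new
letter. -/
theorem rdes_insertMin {n : ℕ} {r : ℕ} (hr : 1 ≤ r) (p : Fin (n + 1)) (e : Equiv.Perm (Fin n)) :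
    rdes r (insertMin p e) = (∑ x : Fin n, if (p : ℕ) = x + 1 ∧ r ≤ (e x : ℕ) + 1 then 1 else 0)
      + ∑ x : Fin n, ∑ y : Fin n,
        if ((y : ℕ) = x + 1 ∧ (e y : ℕ) + r ≤ e x) ∧ (p : ℕ) ≠ y then 1 else 0 := by
  have hval : ∀ j : Fin n, (p.succAbove j : ℕ) = if (j : ℕ) < p then (j : ℕ) else j + 1 := by
    intro j
    simp only [Fin.succAbove, Fin.lt_def, Fin.val_castSucc]
    split_ifs <;> simp
  rw [rdes_eq_sum]
  simp only [Fin.sum_univ_succAbove _ p, insertMin_apply_self, insertMin_apply_succAbove,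
    Fin.val_zero, Fin.val_succ, sum_add_distrib]
  have h1 : (if (p : ℕ) = p + 1 ∧ 0 + r ≤ 0 then 1 else 0) = 0 := if_neg (by omega)
  have h2 : ∑ y : Fin n, (if (p.succAbove y : ℕ) = p + 1 ∧ (e y : ℕ) + 1 + r ≤ 0 then 1 else 0)
      = 0 := sum_eq_zero fun y _ => if_neg (by omega)
  rw [h1, h2, zero_add, zero_add]
  congr 1
  · refine sum_congr rfl fun x _ => if_congr ?_ rfl rfl
    rw [hval]
    split_ifs <;> omega
  · refine sum_congr rfl fun x _ => sum_congr rfl fun y _ => if_congr ?_ rfl rfl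
    rw [hval, hval]
    split_ifs <;> omega

theorem rdes_insertMin_zero {n : ℕ} {r : ℕ} (hr : 1 ≤ r) (e : Equiv.Perm (Fin n)) :
    rdes r (insertMin 0 e) = rdes r e := by
  rw [rdes_insertMin hr, rdes_eq_sum, sum_eq_zero fun x _ => if_neg (by simp), zero_add]
  refine sum_congr rfl fun x _ => sum_congr rfl fun y _ => if_congr ?_ rfl rfl
  simp only [Fin.val_zero]
  omega

/-- The positions of the `r`-descents of `e`. -/
def rdesTops {n : ℕ} (r : ℕ) (e : Equiv.Perm (Fin n)) : Finset (Fin n) :=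
  univ.filter fun x => ∃ y : Fin n, (y : ℕ) = x + 1 ∧ (e y : ℕ) + r ≤ e x

theorem indicator_rdesTops {n : ℕ} (r : ℕ) (e : Equiv.Perm (Fin n)) (x : Fin n) :
    (if x ∈ rdesTops r e then 1 else 0)
      = ∑ y : Fin n, if (y : ℕ) = x + 1 ∧ (e y : ℕ) + r ≤ e x then 1 else 0 := by
  split_ifs with h
  · simp only [rdesTops, mem_filter, mem_univ, true_and] at h
    obtain ⟨y, hy, hd⟩ := h
    rw [sum_eq_single y, if_pos ⟨hy, hd⟩]
    · exact fun z _ hz => if_neg fun h => hz (Fin.ext (by omega))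
    · simp
  · refine (sum_eq_zero fun y _ => if_neg fun hy => h ?_).symm
    simp only [rdesTops, mem_filter, mem_univ, true_and]
    exact ⟨y, hy⟩

theorem card_rdesTops {n : ℕ} (r : ℕ) (e : Equiv.Perm (Fin n)) :
    (rdesTops r e).card = rdes r e := by
  rw [rdes_eq_sum, ← sum_congr rfl fun x _ => indicator_rdesTops r e x]
  simp

theorem rdes_insertMin_succ {n : ℕ} {r : ℕ} (hr : 1 ≤ r) (e : Equiv.Perm (Fin n)) (k : Fin n) :
    rdes r (insertMin k.succ e) + (if k ∈ rdesTops r e then 1 else 0)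
      = rdes r e + (if r ≤ (e k : ℕ) + 1 then 1 else 0) := by
  have hA : (∑ x : Fin n, if (k.succ : ℕ) = x + 1 ∧ r ≤ (e x : ℕ) + 1 then 1 else 0)
      = if r ≤ (e k : ℕ) + 1 then 1 else 0 := by
    rw [sum_eq_single k]
    · simp
    · exact fun x _ hx => if_neg fun h => hx (Fin.ext (by simp at h; omega))
    · simp
  have hB : (∑ y : Fin n, if (y : ℕ) = k + 1 ∧ (e y : ℕ) + r ≤ e k then 1 else 0)
      = ∑ x : Fin n, ∑ y : Fin n,
        if ((y : ℕ) = x + 1 ∧ (e y : ℕ) + r ≤ e x) ∧ (k.succ : ℕ) = y then 1 else 0 := by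
    symm
    rw [sum_eq_single k]
    · refine sum_congr rfl fun y _ => if_congr ?_ rfl rfl
      simp only [Fin.val_succ]
      omega
    · refine fun x _ hx => sum_eq_zero fun y _ => if_neg fun h => hx (Fin.ext ?_)
      have h2 : (k : ℕ) + 1 = y := h.2
      omega
    · simp
  rw [rdes_insertMin hr, hA, indicator_rdesTops, hB, add_assoc, add_comm, rdes_eq_sum]
  congr 1
  simp only [← sum_add_distrib]
  refine sum_congr rfl fun x _ => sum_congr rfl fun y _ => ?_
  by_cases h : (k.succ : ℕ) = y <;>
    simp only [h, ne_eq, not_true_eq_false, not_false_eq_true, and_true, and_false,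
      if_false, add_zero, zero_add]

theorem sum_rdes_succ {r : ℕ} (hr : 1 ≤ r) (n : ℕ) (f : ℕ → ℕ) :
    ∑ σ : Equiv.Perm (Fin (n + 1)), f (rdes r σ)
      = ∑ e : Equiv.Perm (Fin n), insertionSum r n f (rdes r e) := by
  rw [← (insertMin_bijective n).sum_comp, Fintype.sum_prod_type_right]
  refine sum_congr rfl fun e _ => ?_
  rw [Fin.sum_univ_succ, rdes_insertMin_zero hr, insertionSum]
  congr 1
  have hA : (univ.filter fun k : Fin n => r ≤ (e k : ℕ) + 1).card = n + 1 - r := by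
    rw [← card_filter_le_val_succ hr]
    exact card_equiv e fun k => by simp
  rw [sum_comp_of_add_indicator_eq f (rdes r e) _
    (univ.filter fun k : Fin n => r ≤ (e k : ℕ) + 1) (rdesTops r e), hA, card_rdesTops]
  · intro k
    simp only [rdesTops, mem_filter, mem_univ, true_and]
    rintro ⟨y, -, hy⟩
    omega
  · intro k
    simpa only [mem_filter, mem_univ, true_and] using rdes_insertMin_succ hr e k

theorem sum_rdes_eq_sum_rexc {r : ℕ} (hr : 1 ≤ r) (n : ℕ) (f : ℕ → ℕ) :
    ∑ σ : Equiv.Perm (Fin n), f (rdes r σ) = ∑ σ : Equiv.Perm (Fin n), f (rexc r σ) := by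
  induction n generalizing f with
  | zero => simp [rdes, rdesPairs, rexc]
  | succ n ih => rw [sum_rdes_succ hr, sum_rexc_succ hr, ih]

/-- `rdes` and `rexc` are equidistributed over `S_n`. -/
theorem rdes_equidistributed_rexc (r n : ℕ) (hr : 1 ≤ r) (hn : 1 ≤ n) (a : ℕ) :
    ((univ : Finset (Equiv.Perm (Fin n))).filter fun σ => rdes r σ = a).card
      = ((univ : Finset (Equiv.Perm (Fin n))).filter fun σ => rexc r σ = a).card := by
  rw [card_filter, card_filter]
  exact sum_rdes_eq_sum_rexc hr n fun s => if s = a then 1 else 0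

end PaperStmt
end
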